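/- arXiv:2311.07045 — 11 statements merged into one kernel-verified Lean document; each statement's English description precedes it below -/
import Mathlib

section
/- Suppose f_u > 0 > g_v, f_v·g_u < 0, f_u + g_v < 0 and f_u·g_v − f_v·g_u > 0 (so both complex eigenvalues of M have negative real part). Let n ≥ 1 be an integer and suppose D_u·n²·k² < f_u. Then there exists D_v⁰ > 0 such that for every D_v > D_v⁰ one has det M̃_n < 0; consequently, for such D_v the matrix M̃_n has two real eigenvalues of opposite sign, in particular a positive eigenvalue (diffusion-induced/Turing instability of mode n). -/
open Matrix

/-- The matrix `M̃_n = [[−D_u n²k² + f_u, f_v], [g_u, −D_v n²k² + g_v]]`. -/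
noncomputable def Mtilde (fu fv gu gv Du Dv k : ℝ) (n : ℕ) : Matrix (Fin 2) (Fin 2) ℝ :=
  !![-Du * (n : ℝ) ^ 2 * k ^ 2 + fu, fv; gu, -Dv * (n : ℝ) ^ 2 * k ^ 2 + gv]

/-- A real `2 × 2` matrix of negative determinant has two real eigenvalues of opposite sign. -/
theorem Matrix.exists_spectrum_eq_pair_of_det_neg (A : Matrix (Fin 2) (Fin 2) ℝ)
    (hA : A.det < 0) :
    ∃ a b : ℝ, a < 0 ∧ 0 < b ∧ spectrum ℂ (A.map Complex.ofReal) = {(a : ℂ), (b : ℂ)} := by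
  set t := A.trace with ht
  set s := √(t ^ 2 - 4 * A.det) with hs
  have hss : s ^ 2 = t ^ 2 - 4 * A.det := Real.sq_sqrt (by nlinarith [sq_nonneg t])
  have habs : |t| < s := Real.lt_sqrt_of_sq_lt (by rw [sq_abs]; linarith)
  obtain ⟨hneg, hpos⟩ := abs_lt.mp habs
  refine ⟨(t - s) / 2, (t + s) / 2, by linarith, by linarith, ?_⟩
  ext z
  have hssC : (s : ℂ) ^ 2 = (t : ℂ) ^ 2 - 4 * (A.det : ℂ) := by exact_mod_cast hss
  have hchar : (algebraMap ℂ (Matrix (Fin 2) (Fin 2) ℂ) z - A.map Complex.ofReal).det =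
      (z - ((t - s) / 2 : ℝ)) * (z - ((t + s) / 2 : ℝ)) := by
    rw [Matrix.det_fin_two] at hssC
    simp only [ht, Matrix.trace_fin_two] at hssC ⊢
    simp [Matrix.det_fin_two, Matrix.algebraMap_matrix_apply]
    push_cast at hssC
    linear_combination (1 / 4) * hssC
  rw [spectrum.mem_iff, Matrix.isUnit_iff_isUnit_det, hchar, isUnit_iff_ne_zero, not_not,
    mul_eq_zero, sub_eq_zero, sub_eq_zero, Set.mem_insert_iff, Set.mem_singleton_iff]

/-- Diffusion-induced (Turing) instability of mode `n`: if `D_u n² k² < f_u`, then for all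
sufficiently large `D_v` the matrix `M̃_n` has negative determinant, hence two real
eigenvalues of opposite sign. -/
theorem turing_instability_mode_n (fu fv gu gv Du k : ℝ) (n : ℕ)
    (hfu : 0 < fu) (hgv : gv < 0) (hfvgu : fv * gu < 0) (htr : fu + gv < 0)
    (hdet : 0 < fu * gv - fv * gu) (hDu : 0 < Du) (hk : 0 < k)
    (hn : 1 ≤ n) (hmode : Du * (n : ℝ) ^ 2 * k ^ 2 < fu) :
    ∃ Dv0 : ℝ, 0 < Dv0 ∧ ∀ Dv : ℝ, Dv0 < Dv →
      (Mtilde fu fv gu gv Du Dv k n).det < 0 ∧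
      ∃ lam1 lam2 : ℝ, lam1 < 0 ∧ 0 < lam2 ∧
        spectrum ℂ ((Mtilde fu fv gu gv Du Dv k n).map Complex.ofReal) =
          {(lam1 : ℂ), (lam2 : ℂ)} := by
  have hnk : 0 < (n : ℝ) ^ 2 * k ^ 2 := by
    have : 0 < (n : ℝ) := by exact_mod_cast hn
    positivity
  have ha : 0 < fu - Du * (n : ℝ) ^ 2 * k ^ 2 := by linarith
  refine ⟨-(fv * gu) / ((fu - Du * (n : ℝ) ^ 2 * k ^ 2) * ((n : ℝ) ^ 2 * k ^ 2)),
    div_pos (by linarith) (mul_pos ha hnk), fun Dv hDv => ?_⟩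
  rw [div_lt_iff₀ (mul_pos ha hnk)] at hDv
  have hneg : (Mtilde fu fv gu gv Du Dv k n).det < 0 := by
    rw [Mtilde, Matrix.det_fin_two_of]
    linarith [mul_neg_of_pos_of_neg ha hgv]
  exact ⟨hneg, Matrix.exists_spectrum_eq_pair_of_det_neg _ hneg⟩
end

section
/- Suppose f_u > 0 > g_v, f_v·g_u < 0, δ := f_u·g_v − f_v·g_u > 0, and k > 0. Define D_u* := (5δ − √(25δ² − 16 f_u g_v δ))/(8 g_v k²) and D_v* := (g_v k² D_u* − δ)/(k²(k² D_u* − f_u)). Then: (i) D_u* > 0; (ii) k²·D_u* < f_u; (iii) D_v* > 0; and (iv) with (D_u, D_v) = (D_u*, D_v*) the 1 and 2 modes are simultaneously critical, i.e. det M̃_1 = det M̃_2 = 0, equivalently (D_u* k² − f_u)(D_v* k² − g_v) = f_v g_u and (4 D_u* k² − f_u)(4 D_v* k² − g_v) = f_v g_u (the 1:2 degenerate point). -/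
open Matrix

/-- The 1:2 degenerate point: at `(D_u, D_v) = (D_u*, D_v*)` the 1 and 2 modes are
simultaneously critical. -/
theorem one_two_degenerate_point (fu fv gu gv k δ Dustar Dvstar : ℝ)
    (hfu : 0 < fu) (hgv : gv < 0) (hfvgu : fv * gu < 0)
    (hδ : δ = fu * gv - fv * gu) (hδpos : 0 < δ) (hk : 0 < k)
    (hDu : Dustar = (5 * δ - Real.sqrt (25 * δ ^ 2 - 16 * fu * gv * δ)) / (8 * gv * k ^ 2))
    (hDv : Dvstar = (gv * k ^ 2 * Dustar - δ) / (k ^ 2 * (k ^ 2 * Dustar - fu))) :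
    0 < Dustar ∧
    k ^ 2 * Dustar < fu ∧
    0 < Dvstar ∧
    (Mtilde fu fv gu gv Dustar Dvstar k 1).det = 0 ∧
    (Mtilde fu fv gu gv Dustar Dvstar k 2).det = 0 ∧
    (Dustar * k ^ 2 - fu) * (Dvstar * k ^ 2 - gv) = fv * gu ∧
    (4 * Dustar * k ^ 2 - fu) * (4 * Dvstar * k ^ 2 - gv) = fv * gu := by
  obtain ⟨x, hx⟩ : ∃ x, x = k ^ 2 * Dustar := ⟨_, rfl⟩
  obtain ⟨y, hy⟩ : ∃ y, y = k ^ 2 * Dvstar := ⟨_, rfl⟩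
  have hk2 : 0 < k ^ 2 := by positivity
  have hfg : fu * gv < 0 := mul_neg_of_pos_of_neg hfu hgv
  have hdisc : 25 * δ ^ 2 < 25 * δ ^ 2 - 16 * fu * gv * δ := by
    nlinarith [mul_pos (neg_pos.mpr hfg) hδpos]
  have hsqrt : 5 * δ < √(25 * δ ^ 2 - 16 * fu * gv * δ) :=
    Real.lt_sqrt_of_sq_lt (by linarith [mul_pow 5 δ 2])
  have hsq := Real.sq_sqrt ((by positivity : (0 : ℝ) ≤ 25 * δ ^ 2).trans hdisc.le)
  have hDpos : 0 < Dustar := by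
    rw [hDu]
    exact div_pos_of_neg_of_neg (by linarith) (by nlinarith)
  have hxpos : 0 < x := hx ▸ mul_pos hk2 hDpos
  have hlin : 5 * δ - 8 * gv * x = √(25 * δ ^ 2 - 16 * fu * gv * δ) := by
    rw [eq_div_iff (by have := hgv.ne; positivity)] at hDu
    rw [hx]
    linarith
  have hquad : 4 * gv * x ^ 2 - 5 * δ * x + fu * δ = 0 := by
    rw [← hlin] at hsq
    apply mul_left_cancel₀ hgv.ne
    linarith
  have hxlt : x < fu := by
    have hneg : gv * x ^ 2 < 0 := mul_neg_of_neg_of_pos hgv (by positivity)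
    have : δ * (5 * x) < δ * fu := by linarith
    linarith [lt_of_mul_lt_mul_left this hδpos.le]
  have hxfu : x - fu ≠ 0 := by linarith
  have hDvpos : 0 < Dvstar := by
    rw [hDv, mul_assoc gv, ← hx]
    exact div_pos_of_neg_of_neg (by linarith [mul_neg_of_neg_of_pos hgv hxpos])
      (mul_neg_of_pos_of_neg hk2 (by linarith))
  have hylin : y * (x - fu) = gv * x - δ := by
    rw [hDv, ← hx, mul_assoc, ← hx] at hy
    rw [hy]
    field_simp
  have hone : (Dustar * k ^ 2 - fu) * (Dvstar * k ^ 2 - gv) = fv * gu := by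
    rw [mul_comm Dustar, mul_comm Dvstar, ← hx, ← hy]
    linarith
  have htwo : (4 * Dustar * k ^ 2 - fu) * (4 * Dvstar * k ^ 2 - gv) = fv * gu := by
    have h : (4 * x - fu) * (4 * y - gv) = fv * gu := by
      apply mul_left_cancel₀ hxfu
      linear_combination (16 * x - 4 * fu) * hylin + 3 * hquad - (x - fu) * hδ
    rw [← h, hx, hy]
    ring
  refine ⟨hDpos, hx ▸ hxlt, hDvpos, ?_, ?_, hone, htwo⟩
  · rw [Mtilde, Matrix.det_fin_two_of]
    push_cast
    linear_combination hone
  · rw [Mtilde, Matrix.det_fin_two_of]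
    push_cast
    linear_combination htwo
end

section
/- Let D_u > 0, D_v > 0, k > 0 and define q(κ) := (D_u κ − f_u)(D_v κ − g_v) − f_v g_u for κ ∈ ℝ. If q(k²) = q(4k²) = 0 and q(0) = f_u g_v − f_v g_u > 0, then q(n²k²) > 0 for every nonnegative integer n with n ≠ 1 and n ≠ 2; that is, det M̃_n > 0 for all modes n ∉ {1, 2} at the 1:2 degenerate point. -/
/-- At the 1:2 degenerate point, all modes other than 1 and 2 remain stable:
if `q(κ) = (D_u κ − f_u)(D_v κ − g_v) − f_v g_u` vanishes at `κ = k²` and `κ = 4k²` and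
`q(0) > 0`, then `q(n²k²) > 0` for every nonnegative integer `n ∉ {1, 2}`. -/
theorem det_positive_off_degenerate_modes (fu fv gu gv Du Dv k : ℝ) (q : ℝ → ℝ)
    (hDu : 0 < Du) (hDv : 0 < Dv) (hk : 0 < k)
    (hq : ∀ κ : ℝ, q κ = (Du * κ - fu) * (Dv * κ - gv) - fv * gu)
    (h1 : q (k ^ 2) = 0) (h2 : q (4 * k ^ 2) = 0)
    (h0 : q 0 = fu * gv - fv * gu) (h0pos : 0 < q 0) :
    ∀ n : ℕ, n ≠ 1 → n ≠ 2 → 0 < q ((n : ℝ) ^ 2 * k ^ 2) := by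
  have hk2 : k ^ 2 ≠ 0 := by positivity
  rw [hq] at h1 h2
  have hsum : Du * gv + Dv * fu = 5 * (Du * Dv) * k ^ 2 := by
    apply mul_left_cancel₀ hk2
    linear_combination (h1 - h2) / 3
  have hfactor : ∀ κ : ℝ, q κ = Du * Dv * ((κ - k ^ 2) * (κ - 4 * k ^ 2)) := by
    intro κ
    rw [hq]
    linear_combination h1 + (k ^ 2 - κ) * hsum
  intro n hn1 hn2
  have hsplit : q ((n : ℝ) ^ 2 * k ^ 2) =
      Du * Dv * k ^ 4 * (((n : ℝ) ^ 2 - 1) * ((n : ℝ) ^ 2 - 4)) := by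
    rw [hfactor]
    ring
  rw [hsplit]
  refine mul_pos (by positivity) ?_
  obtain rfl | hn : n = 0 ∨ 3 ≤ n := by omega
  · norm_num
  · have hn' : (3 : ℝ) ≤ n := by exact_mod_cast hn
    exact mul_pos (by nlinarith) (by nlinarith)
end

section
/- (Existence of a Hopf–Turing–Turing instability point.) Suppose f_u > 0 > g_v, f_v·g_u < 0, f_u + g_v < 0 and δ := f_u g_v − f_v g_u > 0, and let k > 0. Set α* := −f_u/g_v, D_u* := (5δ − √(25δ² − 16 f_u g_v δ))/(8 g_v k²) and D_v* := (g_v k² D_u* − δ)/(k²(k² D_u* − f_u)). Then, with (D_u, D_v, α) = (D_u*, D_v*, α*): (i) the complex eigenvalues of M_{0,α*} are ±iω with ω = √(α*·δ) > 0; (ii) det M_{1,α*} = det M_{2,α*} = 0 and tr M_{1,α*} < 0, tr M_{2,α*} < 0, so for j = 1, 2 the eigenvalues of M_{j,α*} are 0 and the negative number tr M_{j,α*}; (iii) for every integer n ≥ 3, tr M_{n,α*} < 0 and det M_{n,α*} > 0, so both complex eigenvalues of M_{n,α*} have strictly negative real part. -/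
open Matrix

/-- The matrix `M_{n,α} = [[−D_u n²k² + f_u, f_v], [α g_u, α(−D_v n²k² + g_v)]]`. -/
noncomputable def MnAlpha (fu fv gu gv Du Dv k α : ℝ) (n : ℕ) : Matrix (Fin 2) (Fin 2) ℝ :=
  !![-Du * (n : ℝ) ^ 2 * k ^ 2 + fu, fv;
     α * gu, α * (-Dv * (n : ℝ) ^ 2 * k ^ 2 + gv)]

/-- The complex spectrum of a real `2 × 2` matrix is the zero set of `μ² - tr(A) μ + det A`. -/
theorem mem_spectrum_map_ofReal_iff (A : Matrix (Fin 2) (Fin 2) ℝ) (μ : ℂ) :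
    μ ∈ spectrum ℂ (A.map Complex.ofReal) ↔ μ ^ 2 - (A.trace : ℂ) * μ + (A.det : ℂ) = 0 := by
  have h : (algebraMap ℂ (Matrix (Fin 2) (Fin 2) ℂ) μ - A.map Complex.ofReal).det =
      μ ^ 2 - (A.trace : ℂ) * μ + (A.det : ℂ) := by
    rw [Algebra.algebraMap_eq_smul_one]
    simp [Matrix.det_fin_two, Matrix.trace_fin_two]
    ring
  rw [spectrum.mem_iff, Matrix.isUnit_iff_isUnit_det, isUnit_iff_ne_zero, not_not, h]

theorem spectrum_map_ofReal_of_trace_eq_zero {A : Matrix (Fin 2) (Fin 2) ℝ}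
    (htr : A.trace = 0) (hdet : 0 ≤ A.det) :
    spectrum ℂ (A.map Complex.ofReal) =
      {Complex.I * (Real.sqrt A.det : ℝ), -(Complex.I * (Real.sqrt A.det : ℝ))} := by
  ext μ
  have h : (A.det : ℂ) = (Real.sqrt A.det : ℂ) ^ 2 := by
    exact_mod_cast (Real.sq_sqrt hdet).symm
  rw [mem_spectrum_map_ofReal_iff, Set.mem_insert_iff, Set.mem_singleton_iff,
    ← sq_eq_sq_iff_eq_or_eq_neg, mul_pow, Complex.I_sq, htr, h, Complex.ofReal_zero, zero_mul,
    sub_zero, neg_one_mul, eq_neg_iff_add_eq_zero]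

theorem spectrum_map_ofReal_of_det_eq_zero {A : Matrix (Fin 2) (Fin 2) ℝ} (hdet : A.det = 0) :
    spectrum ℂ (A.map Complex.ofReal) = {(0 : ℂ), (A.trace : ℂ)} := by
  ext μ
  rw [mem_spectrum_map_ofReal_iff, Set.mem_insert_iff, Set.mem_singleton_iff, hdet,
    Complex.ofReal_zero, add_zero, sq, ← sub_mul, mul_eq_zero, sub_eq_zero, or_comm]

theorem re_neg_of_mem_spectrum_map_ofReal {A : Matrix (Fin 2) (Fin 2) ℝ} (htr : A.trace < 0)
    (hdet : 0 < A.det) {μ : ℂ} (hμ : μ ∈ spectrum ℂ (A.map Complex.ofReal)) : μ.re < 0 := by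
  rw [mem_spectrum_map_ofReal_iff] at hμ
  have hre := congrArg Complex.re hμ
  have him := congrArg Complex.im hμ
  simp only [sq, Complex.add_re, Complex.sub_re, Complex.mul_re, Complex.ofReal_re,
    Complex.ofReal_im, Complex.zero_re, Complex.add_im, Complex.sub_im, Complex.mul_im,
    Complex.zero_im, zero_mul, sub_zero, add_zero] at hre him
  by_contra! hneg
  have h : μ.im * (2 * μ.re - A.trace) = 0 := by linarith
  rcases mul_eq_zero.mp h with h | h
  · rw [h] at hre
    nlinarith [mul_nonneg hneg (neg_pos.mpr htr).le, mul_self_nonneg μ.re]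
  · linarith

theorem MnAlpha_trace (fu fv gu gv Du Dv k α : ℝ) (n : ℕ) :
    (MnAlpha fu fv gu gv Du Dv k α n).trace =
      fu + α * gv - (k ^ 2 * Du + α * (k ^ 2 * Dv)) * (n : ℝ) ^ 2 := by
  simp only [MnAlpha, Matrix.trace_fin_two_of]
  ring

theorem MnAlpha_det (fu fv gu gv Du Dv k α : ℝ) (n : ℕ) :
    (MnAlpha fu fv gu gv Du Dv k α n).det =
      α * ((k ^ 2 * Du) * (k ^ 2 * Dv) * ((n : ℝ) ^ 2) ^ 2
        - (fu * (k ^ 2 * Dv) + gv * (k ^ 2 * Du)) * (n : ℝ) ^ 2 + (fu * gv - fv * gu)) := by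
  simp only [MnAlpha, Matrix.det_fin_two_of]
  ring

/-- If `x` is the positive root of `4 g x² - 5 δ x + f δ` and `y = (g x - δ) / (x - f)`, then
the quadratic `x y s² - (f y + g x) s + δ` has positive `x, y` and roots `s = 1, 4`. -/
theorem turing_turing_coefficients {f g δ x y : ℝ} (hf : 0 < f) (hg : g < 0) (hδ : 0 < δ)
    (hx : x = (5 * δ - Real.sqrt (25 * δ ^ 2 - 16 * f * g * δ)) / (8 * g))
    (hy : y = (g * x - δ) / (x - f)) :
    0 < x ∧ 0 < y ∧ 4 * (x * y) = δ ∧ 4 * (f * y + g * x) = 5 * δ := by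
  have hfgδ : 0 < -(f * g) * δ := mul_pos (neg_pos.mpr (mul_neg_of_pos_of_neg hf hg)) hδ
  have hlt : 5 * δ < Real.sqrt (25 * δ ^ 2 - 16 * f * g * δ) :=
    Real.lt_sqrt_of_sq_lt (by nlinarith)
  have hx0 : 0 < x := by
    rw [hx]
    exact div_pos_of_neg_of_neg (by linarith) (by linarith)
  have hsq : Real.sqrt (25 * δ ^ 2 - 16 * f * g * δ) ^ 2 = 25 * δ ^ 2 - 16 * f * g * δ :=
    Real.sq_sqrt (by nlinarith)
  have hsqrt : Real.sqrt (25 * δ ^ 2 - 16 * f * g * δ) = 5 * δ - 8 * g * x := by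
    rw [eq_div_iff (by linarith)] at hx
    linarith
  have hroot : 4 * g * x ^ 2 - 5 * δ * x + f * δ = 0 := by
    rw [hsqrt] at hsq
    have : g * (4 * g * x ^ 2 - 5 * δ * x + f * δ) = 0 := by linarith
    exact (mul_eq_zero.mp this).resolve_left hg.ne
  have hxf : x < f := by
    by_contra! h
    nlinarith [mul_nonneg hx0.le (sub_nonneg.mpr h), mul_pos hx0 hδ, mul_pos hx0 hx0,
      mul_pos (mul_pos hx0 hx0) (neg_pos.mpr hg), mul_nonneg hδ.le (sub_nonneg.mpr h)]
  have hxf' : x - f ≠ 0 := (sub_neg.mpr hxf).ne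
  have hy0 : 0 < y := by
    rw [hy]
    exact div_pos_of_neg_of_neg (by nlinarith) (sub_neg.mpr hxf)
  have hyx : y * (x - f) = g * x - δ := by rw [hy, div_mul_cancel₀ _ hxf']
  have hxy : 4 * (x * y) = δ := by
    apply mul_right_cancel₀ hxf'
    linear_combination 4 * x * hyx + hroot
  exact ⟨hx0, hy0, hxy, by linear_combination hxy - 4 * hyx⟩

/-- Existence of a Hopf–Turing–Turing instability point: at
`(D_u, D_v, α) = (D_u*, D_v*, α*)`, the 0-mode has purely imaginary eigenvalues `±iω`,
modes 1 and 2 have eigenvalues `0` and a negative number, and all modes `n ≥ 3` are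
strictly stable. -/
theorem hopf_turing_turing_instability_point (fu fv gu gv k δ αstar Dustar Dvstar : ℝ)
    (hfu : 0 < fu) (hgv : gv < 0) (hfvgu : fv * gu < 0) (htr : fu + gv < 0)
    (hδ : δ = fu * gv - fv * gu) (hδpos : 0 < δ) (hk : 0 < k)
    (hα : αstar = -fu / gv)
    (hDu : Dustar = (5 * δ - Real.sqrt (25 * δ ^ 2 - 16 * fu * gv * δ)) / (8 * gv * k ^ 2))
    (hDv : Dvstar = (gv * k ^ 2 * Dustar - δ) / (k ^ 2 * (k ^ 2 * Dustar - fu))) :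
    (0 < Real.sqrt (αstar * δ) ∧
      spectrum ℂ ((MnAlpha fu fv gu gv Dustar Dvstar k αstar 0).map Complex.ofReal) =
        {Complex.I * (Real.sqrt (αstar * δ) : ℝ),
         -(Complex.I * (Real.sqrt (αstar * δ) : ℝ))}) ∧
    ((MnAlpha fu fv gu gv Dustar Dvstar k αstar 1).det = 0 ∧
     (MnAlpha fu fv gu gv Dustar Dvstar k αstar 2).det = 0 ∧
     (MnAlpha fu fv gu gv Dustar Dvstar k αstar 1).trace < 0 ∧
     (MnAlpha fu fv gu gv Dustar Dvstar k αstar 2).trace < 0 ∧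
     spectrum ℂ ((MnAlpha fu fv gu gv Dustar Dvstar k αstar 1).map Complex.ofReal) =
       {(0 : ℂ), ((MnAlpha fu fv gu gv Dustar Dvstar k αstar 1).trace : ℂ)} ∧
     spectrum ℂ ((MnAlpha fu fv gu gv Dustar Dvstar k αstar 2).map Complex.ofReal) =
       {(0 : ℂ), ((MnAlpha fu fv gu gv Dustar Dvstar k αstar 2).trace : ℂ)}) ∧
    (∀ n : ℕ, 3 ≤ n →
      (MnAlpha fu fv gu gv Dustar Dvstar k αstar n).trace < 0 ∧
      0 < (MnAlpha fu fv gu gv Dustar Dvstar k αstar n).det ∧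
      ∀ μ ∈ spectrum ℂ ((MnAlpha fu fv gu gv Dustar Dvstar k αstar n).map Complex.ofReal),
        μ.re < 0) := by
  have hk2 : k ^ 2 ≠ 0 := (pow_pos hk 2).ne'
  have hα0 : 0 < αstar := hα ▸ div_pos_of_neg_of_neg (neg_neg_of_pos hfu) hgv
  have hαgv : fu + αstar * gv = 0 := by
    rw [hα, div_mul_cancel₀ _ hgv.ne, add_neg_cancel]
  obtain ⟨hx, hy, hxy, hlin⟩ := turing_turing_coefficients (x := k ^ 2 * Dustar)
    (y := k ^ 2 * Dvstar) hfu hgv hδpos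
    (by rw [hDu]; field_simp)
    (by rw [hDv, ← mul_div_assoc, mul_div_mul_left _ _ hk2, mul_assoc])
  have htrace (n : ℕ) : (MnAlpha fu fv gu gv Dustar Dvstar k αstar n).trace =
      -((k ^ 2 * Dustar + αstar * (k ^ 2 * Dvstar)) * (n : ℝ) ^ 2) := by
    rw [MnAlpha_trace, hαgv, zero_sub]
  have hdet (n : ℕ) : (MnAlpha fu fv gu gv Dustar Dvstar k αstar n).det =
      αstar * δ / 4 * (((n : ℝ) ^ 2 - 1) * ((n : ℝ) ^ 2 - 4)) := by
    rw [MnAlpha_det, ← hδ]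
    linear_combination αstar / 4 * ((n : ℝ) ^ 2) ^ 2 * hxy - αstar / 4 * (n : ℝ) ^ 2 * hlin
  have htrace_neg (n : ℕ) (hn : 0 < n) :
      (MnAlpha fu fv gu gv Dustar Dvstar k αstar n).trace < 0 := by
    rw [htrace]
    have : (0 : ℝ) < n := Nat.cast_pos.mpr hn
    exact neg_neg_of_pos (by positivity)
  have hdet0 : (MnAlpha fu fv gu gv Dustar Dvstar k αstar 0).det = αstar * δ := by
    rw [hdet]
    norm_num
  have hdet1 : (MnAlpha fu fv gu gv Dustar Dvstar k αstar 1).det = 0 := by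
    rw [hdet]
    norm_num
  have hdet2 : (MnAlpha fu fv gu gv Dustar Dvstar k αstar 2).det = 0 := by
    rw [hdet]
    norm_num
  have hαδ : 0 < αstar * δ := mul_pos hα0 hδpos
  refine ⟨⟨Real.sqrt_pos.mpr hαδ, ?_⟩, ⟨hdet1, hdet2, htrace_neg 1 one_pos,
    htrace_neg 2 two_pos, spectrum_map_ofReal_of_det_eq_zero hdet1,
    spectrum_map_ofReal_of_det_eq_zero hdet2⟩, fun n hn => ?_⟩
  · rw [← hdet0]
    exact spectrum_map_ofReal_of_trace_eq_zero (by rw [htrace]; simp) (hdet0 ▸ hαδ.le)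
  · have hdet_pos : 0 < (MnAlpha fu fv gu gv Dustar Dvstar k αstar n).det := by
      have hn' : (3 : ℝ) ≤ n := by exact_mod_cast hn
      have hn2 : (9 : ℝ) ≤ (n : ℝ) ^ 2 := by nlinarith
      rw [hdet]
      exact mul_pos (by linarith) (mul_pos (by linarith) (by linarith))
    have htr_neg := htrace_neg n (by omega)
    exact ⟨htr_neg, hdet_pos, fun μ => re_neg_of_mem_spectrum_map_ofReal htr_neg hdet_pos⟩
end

section
/- Assume Δ := σ₁σ₂ − d₀₂d₂₀ ≠ 0. Then a point (r₀, 0, z₂) ∈ ℝ³ with vanishing middle component is an equilibrium of system (24) (i.e. the right-hand side vanishes there) if and only if exactly one of the following holds: (i) r₀ = 0 and z₂ = 0 (the trivial state O); (ii) z₂ = 0 and σ₁ r₀² = −μ₀ (pure 0-mode PM₀, requiring μ₀σ₁ ≤ 0); (iii) r₀ = 0 and σ₂ z₂² = −μ₂ (pure 2-mode PM₂^±, requiring μ₂σ₂ ≤ 0); (iv) r₀ ≠ 0, z₂ ≠ 0, r₀² = (d₀₂ μ₂ − σ₂ μ₀)/Δ and z₂² = (d₂₀ μ₀ − σ₁ μ₂)/Δ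 (the 0:2 mixed modes MM₀:₂^±). -/
/-- The right-hand side of the truncated normal-form system (24) on ℝ³. -/
noncomputable def NF24 (μ₀ μ₁ μ₂ d01 d02 d10 d11 d12 d20 d21 s1 s2 s3 : ℝ)
    (p : Fin 3 → ℝ) : Fin 3 → ℝ :=
  ![(μ₀ + s1 * (p 0) ^ 2 + d01 * (p 1) ^ 2 + d02 * (p 2) ^ 2) * p 0,
    (μ₁ + d10 * (p 0) ^ 2 + d11 * (p 1) ^ 2 + d12 * (p 2) ^ 2) * p 1 + p 1 * p 2,
    (μ₂ + d20 * (p 0) ^ 2 + d21 * (p 1) ^ 2 + s2 * (p 2) ^ 2) * p 2 + s3 * (p 1) ^ 2]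

/-- On the plane where the middle component vanishes, the equilibrium equations decouple into
two factored equations. -/
theorem NF24_middle_zero_iff (μ₀ μ₁ μ₂ d01 d02 d10 d11 d12 d20 d21 s1 s2 s3 r0 z2 : ℝ) :
    NF24 μ₀ μ₁ μ₂ d01 d02 d10 d11 d12 d20 d21 s1 s2 s3 ![r0, 0, z2] = 0 ↔
      (μ₀ + s1 * r0 ^ 2 + d02 * z2 ^ 2 = 0 ∨ r0 = 0) ∧
      (μ₂ + d20 * r0 ^ 2 + s2 * z2 ^ 2 = 0 ∨ z2 = 0) := by
  simp [NF24, funext_iff, Fin.forall_fin_succ]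

/-- Cramer's rule for a pair of linear equations in two unknowns. -/
theorem linear_pair_iff {K : Type*} [Field K] {a b c d m n : K} (h : a * d - b * c ≠ 0)
    (x y : K) :
    (m + a * x + b * y = 0 ∧ n + c * x + d * y = 0) ↔
      x = (b * n - d * m) / (a * d - b * c) ∧ y = (c * m - a * n) / (a * d - b * c) := by
  rw [eq_div_iff h, eq_div_iff h]
  constructor
  · rintro ⟨h₁, h₂⟩
    constructor
    · linear_combination d * h₁ - b * h₂
    · linear_combination a * h₂ - c * h₁
  · rintro ⟨hx, hy⟩
    constructor <;> apply mul_left_cancel₀ h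
    · linear_combination a * hx + b * hy
    · linear_combination c * hx + d * hy

/-- Classification of the equilibria of system (24) with vanishing middle component:
trivial state O, pure 0-mode PM₀, pure 2-mode PM₂^±, and 0:2 mixed modes MM₀:₂^±;
exactly one of the four cases holds. -/
theorem equilibria_with_z1_zero (μ₀ μ₁ μ₂ d01 d02 d10 d11 d12 d20 d21 s1 s2 s3 : ℝ)
    (hs1 : s1 = 1 ∨ s1 = -1) (hs2 : s2 = 1 ∨ s2 = -1) (hs3 : s3 = 1 ∨ s3 = -1)
    (hΔ : s1 * s2 - d02 * d20 ≠ 0) (r0 z2 : ℝ) :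
    let P1 : Prop := r0 = 0 ∧ z2 = 0
    let P2 : Prop := r0 ≠ 0 ∧ z2 = 0 ∧ s1 * r0 ^ 2 = -μ₀
    let P3 : Prop := r0 = 0 ∧ z2 ≠ 0 ∧ s2 * z2 ^ 2 = -μ₂
    let P4 : Prop := r0 ≠ 0 ∧ z2 ≠ 0 ∧
      r0 ^ 2 = (d02 * μ₂ - s2 * μ₀) / (s1 * s2 - d02 * d20) ∧
      z2 ^ 2 = (d20 * μ₀ - s1 * μ₂) / (s1 * s2 - d02 * d20)
    NF24 μ₀ μ₁ μ₂ d01 d02 d10 d11 d12 d20 d21 s1 s2 s3 ![r0, 0, z2] = 0 ↔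
      ((P1 ∧ ¬P2 ∧ ¬P3 ∧ ¬P4) ∨ (¬P1 ∧ P2 ∧ ¬P3 ∧ ¬P4) ∨
       (¬P1 ∧ ¬P2 ∧ P3 ∧ ¬P4) ∨ (¬P1 ∧ ¬P2 ∧ ¬P3 ∧ P4)) := by
  intro P1 P2 P3 P4
  rw [NF24_middle_zero_iff]
  by_cases hr : r0 = 0 <;> by_cases hz : z2 = 0
  · simp [P1, P2, P3, P4, hr, hz]
  · simp [P1, P2, P3, P4, hr, hz, eq_neg_iff_add_eq_zero, add_comm]
  · simp [P1, P2, P3, P4, hr, hz, eq_neg_iff_add_eq_zero, add_comm]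
  · simpa [P1, P2, P3, P4, hr, hz] using linear_pair_iff hΔ (r0 ^ 2) (z2 ^ 2)
end

section
/- Let ρ ≠ 0 and z₂ ≠ 0 be real numbers, set z₁ := ρ z₂, and assume the 1:2 mixed-mode equilibrium conditions μ₁ + (d₁₁ρ² + d₁₂) z₂² + z₂ = 0 and μ₂ + (d₂₁ρ² + σ₂) z₂² + σ₃ ρ² z₂ = 0, so that (0, z₁, z₂) is an equilibrium of system (24). Then the Jacobian matrix of (24) at (0, z₁, z₂) equals M := [[μ₀ + (d₀₁ρ² + d₀₂) z₂², 0, 0], [0, 2 d₁₁ ρ² z₂², (2 d₁₂ z₂ + 1) ρ z₂], [0, 2 ρ z₂ (d₂₁ z₂ + σ₃), (2 σ₂ z₂ − σ₃ ρ²) z₂]], and the multiset of complex eigenvalues of M equals {0, iω, −iω} for some ω > 0 if and only if the following three conditions hold: μ₀ = −(d₀₁ρ² + d₀₂) z₂², 2(d₁₁ρ² + σ₂) z₂ = σ₃ ρ², and d₁₁ (2σ₂ z₂ − σ₃ρ²) z₂ − (2 d₁₂ z₂ + 1)(d₂₁ z₂ + σ₃) > 0. -/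
/-- The Jacobian matrix of a map `F : ℝ³ → ℝ³` at a point. -/
noncomputable def jacobianMatrix (F : (Fin 3 → ℝ) → (Fin 3 → ℝ)) (p : Fin 3 → ℝ) :
    Matrix (Fin 3) (Fin 3) ℝ :=
  fun i j => fderiv ℝ F p (Pi.single j 1) i

/-- The Jacobian matrix of the truncated normal-form system at a point of the plane `r₀ = 0`. -/
theorem jacobianMatrix_NF24_of_r0_eq_zero
    (μ₀ μ₁ μ₂ d01 d02 d10 d11 d12 d20 d21 s1 s2 s3 x y : ℝ) :
    jacobianMatrix (NF24 μ₀ μ₁ μ₂ d01 d02 d10 d11 d12 d20 d21 s1 s2 s3) ![0, x, y] =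
      !![μ₀ + d01 * x ^ 2 + d02 * y ^ 2, 0, 0;
         0, μ₁ + 3 * d11 * x ^ 2 + d12 * y ^ 2 + y, 2 * d12 * x * y + x;
         0, 2 * d21 * x * y + 2 * s3 * x, μ₂ + d21 * x ^ 2 + 3 * s2 * y ^ 2] := by
  set p : Fin 3 → ℝ := ![0, x, y] with hp
  have hc (i : Fin 3) : HasFDerivAt (fun q : Fin 3 → ℝ => q i)
      (ContinuousLinearMap.proj (R := ℝ) (φ := fun _ : Fin 3 => ℝ) i) p := hasFDerivAt_apply i p
  have hq (a b c d : ℝ) := ((((hc 0).pow 2).const_mul b).const_add a).add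
    (((hc 1).pow 2).const_mul c) |>.add (((hc 2).pow 2).const_mul d)
  have h0 := (hq μ₀ s1 d01 d02).mul (hc 0)
  have h1 := ((hq μ₁ d10 d11 d12).mul (hc 1)).add ((hc 1).mul (hc 2))
  have h2 := ((hq μ₂ d20 d21 s2).mul (hc 2)).add (((hc 1).pow 2).const_mul s3)
  have hpi {A B C : (Fin 3 → ℝ) →L[ℝ] ℝ} {f : (Fin 3 → ℝ) → Fin 3 → ℝ}
      (hA : HasFDerivAt (fun q => f q 0) A p) (hB : HasFDerivAt (fun q => f q 1) B p)
      (hC : HasFDerivAt (fun q => f q 2) C p) :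
      HasFDerivAt f (ContinuousLinearMap.pi fun i => (![A, B, C] : Fin 3 → _) i) p := by
    refine hasFDerivAt_pi'.2 fun i => ?_
    fin_cases i
    exacts [hA, hB, hC]
  have h := hpi (f := NF24 μ₀ μ₁ μ₂ d01 d02 d10 d11 d12 d20 d21 s1 s2 s3) h0 h1 h2
  ext i j
  rw [jacobianMatrix, h.fderiv]
  fin_cases i <;> fin_cases j <;> simp [hp] <;> ring

/-- The characteristic polynomial of a real matrix with diagonal blocks of sizes one and two. -/
theorem charpoly_map_ofReal_block (a b c d e : ℝ) :
    ((!![a, 0, 0; 0, b, c; 0, d, e] : Matrix (Fin 3) (Fin 3) ℝ).map Complex.ofReal).charpoly =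
      (Polynomial.X - Polynomial.C (a : ℂ)) *
        (Polynomial.X ^ 2 - Polynomial.C ((b + e : ℝ) : ℂ) * Polynomial.X +
          Polynomial.C ((b * e - c * d : ℝ) : ℂ)) := by
  rw [Matrix.charpoly, Matrix.det_fin_three]
  simp
  ring

/-- A real matrix with diagonal blocks of sizes one and two has the eigenvalues `0, iω, -iω` for
some `ω > 0` exactly if the first block vanishes and the second has zero trace and positive
determinant. -/
theorem exists_roots_charpoly_block_eq_iff (a b c d e : ℝ) :
    (∃ ω : ℝ, 0 < ω ∧
      ((!![a, 0, 0; 0, b, c; 0, d, e] : Matrix (Fin 3) (Fin 3) ℝ).map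
        Complex.ofReal).charpoly.roots =
          {(0 : ℂ), Complex.I * (ω : ℝ), -(Complex.I * (ω : ℝ))}) ↔
      a = 0 ∧ b + e = 0 ∧ 0 < b * e - c * d := by
  have hprod (ω : ℝ) : (({(0 : ℂ), Complex.I * (ω : ℝ), -(Complex.I * (ω : ℝ))} :
      Multiset ℂ).map fun z => Polynomial.X - Polynomial.C z).prod =
      Polynomial.X * (Polynomial.X ^ 2 + Polynomial.C ((ω ^ 2 : ℝ) : ℂ)) := by
    have hI : (Polynomial.C Complex.I) ^ 2 = (-1 : Polynomial ℂ) := by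
      rw [← Polynomial.C_pow, Complex.I_sq]; simp
    simp
    linear_combination (-Polynomial.C (ω : ℂ) ^ 2) * hI
  constructor
  · rintro ⟨ω, hω, h⟩
    have hs := (IsAlgClosed.splits ((!![a, 0, 0; 0, b, c; 0, d, e] :
      Matrix (Fin 3) (Fin 3) ℝ).map Complex.ofReal).charpoly).eq_prod_roots_of_monic
      (Matrix.charpoly_monic _)
    rw [h, hprod, charpoly_map_ofReal_block] at hs
    have hev (x : ℝ) : (x - a) * (x ^ 2 - (b + e) * x + (b * e - c * d)) = x * (x ^ 2 + ω ^ 2) := by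
      have := congrArg (Polynomial.eval (x : ℂ)) hs
      simp only [Polynomial.eval_mul, Polynomial.eval_sub, Polynomial.eval_add,
        Polynomial.eval_pow, Polynomial.eval_X, Polynomial.eval_C] at this
      exact_mod_cast this
    have e0 := hev 0
    have e1 := hev 1
    have e2 := hev (-1)
    generalize b + e = t at *
    generalize b * e - c * d = D at *
    have ht : t = -a := by linarith
    subst ht
    have hD : D = ω ^ 2 + a ^ 2 := by linarith
    have hDpos : 0 < D := by rw [hD]; positivity
    have ha : a = 0 := by
      have : a * D = 0 := by linarith
      exact (mul_eq_zero.1 this).resolve_right hDpos.ne'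
    exact ⟨ha, by simp [ha], hDpos⟩
  · rintro ⟨ha, ht, hD⟩
    refine ⟨√(b * e - c * d), Real.sqrt_pos.2 hD, ?_⟩
    rw [← Polynomial.roots_multiset_prod_X_sub_C {(0 : ℂ), _, _}, hprod, Real.sq_sqrt hD.le,
      charpoly_map_ofReal_block, ha, ht]
    simp

/-- At a 1:2 mixed-mode equilibrium `(0, ρ z₂, z₂)` of system (24), the Jacobian has the
stated block form, and its complex eigenvalues (with multiplicity) are `{0, iω, −iω}`
for some `ω > 0` if and only if the three stated conditions hold. -/
theorem jacobian_at_mixed_mode_12 (μ₀ μ₁ μ₂ d01 d02 d10 d11 d12 d20 d21 s1 s2 s3 : ℝ)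
    (hs1 : s1 = 1 ∨ s1 = -1) (hs2 : s2 = 1 ∨ s2 = -1) (hs3 : s3 = 1 ∨ s3 = -1)
    (ρ z2 : ℝ) (hρ : ρ ≠ 0) (hz2 : z2 ≠ 0)
    (heq1 : μ₁ + (d11 * ρ ^ 2 + d12) * z2 ^ 2 + z2 = 0)
    (heq2 : μ₂ + (d21 * ρ ^ 2 + s2) * z2 ^ 2 + s3 * ρ ^ 2 * z2 = 0) :
    let M : Matrix (Fin 3) (Fin 3) ℝ :=
      !![μ₀ + (d01 * ρ ^ 2 + d02) * z2 ^ 2, 0, 0;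
         0, 2 * d11 * ρ ^ 2 * z2 ^ 2, (2 * d12 * z2 + 1) * ρ * z2;
         0, 2 * ρ * z2 * (d21 * z2 + s3), (2 * s2 * z2 - s3 * ρ ^ 2) * z2]
    jacobianMatrix (NF24 μ₀ μ₁ μ₂ d01 d02 d10 d11 d12 d20 d21 s1 s2 s3)
        ![0, ρ * z2, z2] = M ∧
    ((∃ ω : ℝ, 0 < ω ∧
        (M.map Complex.ofReal).charpoly.roots =
          {(0 : ℂ), Complex.I * (ω : ℝ), -(Complex.I * (ω : ℝ))}) ↔
      (μ₀ = -(d01 * ρ ^ 2 + d02) * z2 ^ 2 ∧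
       2 * (d11 * ρ ^ 2 + s2) * z2 = s3 * ρ ^ 2 ∧
       0 < d11 * (2 * s2 * z2 - s3 * ρ ^ 2) * z2 -
            (2 * d12 * z2 + 1) * (d21 * z2 + s3))) := by
  intro M
  constructor
  · rw [jacobianMatrix_NF24_of_r0_eq_zero]
    ext i j
    fin_cases i <;> fin_cases j <;> simp [M]
    · ring
    · linear_combination heq1
    · ring
    · ring
    · linear_combination heq2
  · rw [exists_roots_charpoly_block_eq_iff]
    have hdet : 2 * d11 * ρ ^ 2 * z2 ^ 2 * ((2 * s2 * z2 - s3 * ρ ^ 2) * z2) -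
        (2 * d12 * z2 + 1) * ρ * z2 * (2 * ρ * z2 * (d21 * z2 + s3)) =
        2 * ρ ^ 2 * z2 ^ 2 * (d11 * (2 * s2 * z2 - s3 * ρ ^ 2) * z2 -
          (2 * d12 * z2 + 1) * (d21 * z2 + s3)) := by ring
    rw [hdet, mul_pos_iff_of_pos_left (by positivity)]
    refine and_congr ⟨fun h => by linarith, fun h => by linarith⟩ (and_congr_left' ?_)
    have htr : 2 * d11 * ρ ^ 2 * z2 ^ 2 + (2 * s2 * z2 - s3 * ρ ^ 2) * z2 =
        z2 * (2 * (d11 * ρ ^ 2 + s2) * z2 - s3 * ρ ^ 2) := by ring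
    rw [htr, mul_eq_zero, or_iff_right hz2, sub_eq_zero]
end

section
/- Assume σ₃ = −1, let ρ ≠ 0 be real and assume s := σ₂ + d₁₁ρ² ≠ 0. Define z₂* := −ρ²/(2s), z₁* := ρ z₂*, μ₀* := −(d₀₁ρ² + d₀₂)(z₂*)², μ₁* := −(d₁₁ρ² + d₁₂)(z₂*)² − z₂*, and μ₂* := −(d₂₁ρ² + σ₂)(z₂*)² + ρ² z₂*. Then: (i) μ₂* = −ρ⁴((2d₁₁ + d₂₁)ρ² + 3σ₂)/(4s²); (ii) with parameters (μ₀, μ₁, μ₂) = (μ₀*, μ₁*, μ₂*), the point (0, z₁*, z₂*) is an equilibrium of system (24) whose Jacobian has first row zero (hence eigenvalue 0) and whose lower-right 2×2 block in the (z₁, z₂) variables has trace 0; (iii) if in addition d₁₁(2σ₂ z₂* + ρ²) z₂* − (2 d₁₂ z₂* + 1)(d₂₁ z₂* − 1) > 0, then the multiset of complex eigenvalues of that Jacobian is {0, iω, −iω} for some ω > 0 (a Hopf–Hopf point in the normal form). -/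
open Polynomial in
/-- The characteristic polynomial of a `3 × 3` matrix with vanishing first row. -/
theorem charpoly_fin_three_of_row_zero {R : Type*} [CommRing R] (A : Matrix (Fin 3) (Fin 3) R)
    (h : ∀ j, A 0 j = 0) :
    A.charpoly =
      X * (X ^ 2 - C (A 1 1 + A 2 2) * X + C (A 1 1 * A 2 2 - A 1 2 * A 2 1)) := by
  rw [Matrix.charpoly, Matrix.det_fin_three]
  simp [h]
  ring

/-- A complex `3 × 3` matrix with vanishing first row whose remaining diagonal block has trace `0`
and determinant `ω ^ 2` has eigenvalues `0, ±iω`. -/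
theorem roots_charpoly_fin_three_of_row_zero (A : Matrix (Fin 3) (Fin 3) ℂ) (ω : ℂ)
    (h : ∀ j, A 0 j = 0) (htr : A 1 1 + A 2 2 = 0)
    (hdet : A 1 1 * A 2 2 - A 1 2 * A 2 1 = ω ^ 2) :
    A.charpoly.roots = {0, Complex.I * ω, -(Complex.I * ω)} := by
  open Polynomial in
  have hprod : A.charpoly =
      (({0, Complex.I * ω, -(Complex.I * ω)} : Multiset ℂ).map fun a => X - C a).prod := by
    have hI : (C Complex.I : ℂ[X]) ^ 2 = -1 := by
      rw [← C_pow, Complex.I_sq, C_neg, C_1]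
    rw [charpoly_fin_three_of_row_zero A h, htr, hdet]
    simp
    linear_combination C ω ^ 2 * hI
  rw [hprod, Polynomial.roots_multiset_prod_X_sub_C]

/-- The Jacobian of the normal form on the invariant plane `r₀ = 0`. -/
theorem jacobianMatrix_NF24 (μ₀ μ₁ μ₂ d01 d02 d10 d11 d12 d20 d21 s1 s2 s3 y z : ℝ) :
    jacobianMatrix (NF24 μ₀ μ₁ μ₂ d01 d02 d10 d11 d12 d20 d21 s1 s2 s3) ![0, y, z] =
      !![μ₀ + d01 * y ^ 2 + d02 * z ^ 2, 0, 0;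
        0, μ₁ + 3 * d11 * y ^ 2 + d12 * z ^ 2 + z, 2 * d12 * y * z + y;
        0, 2 * d21 * y * z + 2 * s3 * y, μ₂ + d21 * y ^ 2 + 3 * s2 * z ^ 2] := by
  set p : Fin 3 → ℝ := ![0, y, z] with hp
  have h (k : Fin 3) : HasFDerivAt (fun q : Fin 3 → ℝ => q k)
      (ContinuousLinearMap.proj (R := ℝ) (φ := fun _ : Fin 3 => ℝ) k) p := hasFDerivAt_apply k p
  have h0 := ((((h 0).pow 2).const_mul s1 |>.const_add μ₀).add
    (((h 1).pow 2).const_mul d01)).add (((h 2).pow 2).const_mul d02) |>.mul (h 0)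
  have h1 := (((((h 0).pow 2).const_mul d10 |>.const_add μ₁).add
    (((h 1).pow 2).const_mul d11)).add (((h 2).pow 2).const_mul d12) |>.mul (h 1)).add
    ((h 1).mul (h 2))
  have h2 := (((((h 0).pow 2).const_mul d20 |>.const_add μ₂).add
    (((h 1).pow 2).const_mul d21)).add (((h 2).pow 2).const_mul s2) |>.mul (h 2)).add
    (((h 1).pow 2).const_mul s3)
  have hF : DifferentiableAt ℝ (NF24 μ₀ μ₁ μ₂ d01 d02 d10 d11 d12 d20 d21 s1 s2 s3) p := by
    refine differentiableAt_pi.2 fun i => ?_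
    fin_cases i
    exacts [h0.differentiableAt, h1.differentiableAt, h2.differentiableAt]
  have hrow := hasFDerivAt_pi'.1 hF.hasFDerivAt
  have e0 := (hrow 0).unique h0
  have e1 := (hrow 1).unique h1
  have e2 := (hrow 2).unique h2
  ext i j
  fin_cases i
  · refine (DFunLike.congr_fun e0 (Pi.single j 1)).trans ?_
    fin_cases j <;> simp [hp]
  · refine (DFunLike.congr_fun e1 (Pi.single j 1)).trans ?_
    fin_cases j <;> simp [hp] <;> ring
  · refine (DFunLike.congr_fun e2 (Pi.single j 1)).trans ?_
    fin_cases j <;> simp [hp] <;> ring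

/-- A Hopf–Hopf point of the normal form: with `σ₃ = −1` and the stated parameter values,
`(0, z₁*, z₂*)` is an equilibrium whose Jacobian has first row zero (hence eigenvalue 0)
and whose lower-right 2×2 block is trace-free; under the additional positivity condition
the eigenvalues are `{0, iω, −iω}` with `ω > 0`. -/
theorem hopf_hopf_point_NF24 (d01 d02 d10 d11 d12 d20 d21 s1 s2 s3 : ℝ)
    (hs1 : s1 = 1 ∨ s1 = -1) (hs2 : s2 = 1 ∨ s2 = -1) (hσ3 : s3 = -1)
    (ρ : ℝ) (hρ : ρ ≠ 0) (hs : s2 + d11 * ρ ^ 2 ≠ 0) :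
    let z2s : ℝ := -ρ ^ 2 / (2 * (s2 + d11 * ρ ^ 2))
    let z1s : ℝ := ρ * z2s
    let μ0s : ℝ := -(d01 * ρ ^ 2 + d02) * z2s ^ 2
    let μ1s : ℝ := -(d11 * ρ ^ 2 + d12) * z2s ^ 2 - z2s
    let μ2s : ℝ := -(d21 * ρ ^ 2 + s2) * z2s ^ 2 + ρ ^ 2 * z2s
    let J : Matrix (Fin 3) (Fin 3) ℝ :=
      jacobianMatrix (NF24 μ0s μ1s μ2s d01 d02 d10 d11 d12 d20 d21 s1 s2 s3)
        ![0, z1s, z2s]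
    (μ2s = -ρ ^ 4 * ((2 * d11 + d21) * ρ ^ 2 + 3 * s2) / (4 * (s2 + d11 * ρ ^ 2) ^ 2)) ∧
    (NF24 μ0s μ1s μ2s d01 d02 d10 d11 d12 d20 d21 s1 s2 s3 ![0, z1s, z2s] = 0) ∧
    (∀ j : Fin 3, J 0 j = 0) ∧
    ((0 : ℂ) ∈ (J.map Complex.ofReal).charpoly.roots) ∧
    (J 1 1 + J 2 2 = 0) ∧
    (0 < d11 * (2 * s2 * z2s + ρ ^ 2) * z2s - (2 * d12 * z2s + 1) * (d21 * z2s - 1) →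
      ∃ ω : ℝ, 0 < ω ∧
        (J.map Complex.ofReal).charpoly.roots =
          {(0 : ℂ), Complex.I * (ω : ℝ), -(Complex.I * (ω : ℝ))}) := by
  intro z2s z1s μ0s μ1s μ2s J
  have hz : 2 * (s2 + d11 * ρ ^ 2) * z2s = -ρ ^ 2 := by
    simp only [z2s]
    field_simp
  have hz0 : z2s ≠ 0 := by
    intro h
    rw [h, mul_zero] at hz
    exact hρ (by simpa using hz.symm)
  have hJ : J = _ := jacobianMatrix_NF24 ..
  have hrow : ∀ j, J 0 j = 0 := by
    intro j
    rw [hJ]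
    fin_cases j <;> simp [μ0s, z1s]
    ring
  have htr : J 1 1 + J 2 2 = 0 := by
    rw [hJ]
    simp [μ1s, μ2s, z1s]
    linear_combination z2s * hz
  have hdet : J 1 1 * J 2 2 - J 1 2 * J 2 1 = 2 * z1s ^ 2 *
      (d11 * (2 * s2 * z2s + ρ ^ 2) * z2s - (2 * d12 * z2s + 1) * (d21 * z2s - 1)) := by
    rw [hJ]
    simp [μ1s, μ2s, z1s, hσ3]
    ring
  have hrow' : ∀ j, J.map Complex.ofReal 0 j = 0 := by simp [hrow]
  refine ⟨?_, ?_, hrow, ?_, htr, fun hpos => ?_⟩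
  · simp only [μ2s, z2s]
    field_simp
    ring
  · ext i
    fin_cases i <;> simp [NF24, μ1s, μ2s, z1s, hσ3] <;> ring
  · rw [Polynomial.mem_roots (Matrix.charpoly_monic _).ne_zero,
      charpoly_fin_three_of_row_zero _ hrow']
    simp
  · have hz1 : z1s ≠ 0 := mul_ne_zero hρ hz0
    have hdet_pos : 0 < J 1 1 * J 2 2 - J 1 2 * J 2 1 := by
      rw [hdet]
      positivity
    refine ⟨√(J 1 1 * J 2 2 - J 1 2 * J 2 1), Real.sqrt_pos.2 hdet_pos,
      roots_charpoly_fin_three_of_row_zero _ _ hrow' ?_ ?_⟩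
    · simpa using congrArg Complex.ofReal htr
    · rw [← Complex.ofReal_pow, Real.sq_sqrt hdet_pos.le]
      simp
end

section
/- Consider the planar system ρ̇₀ = (ν₀ + ρ₀² + b ρ₁₂²) ρ₀, ρ̇₁₂ = (ν₁₂ + c ρ₀² − ρ₁₂²) ρ₁₂ (i.e. d = −1) and assume b > 0, c < 0 and d − bc = −1 − bc > 0 (case VIa). Let ρ₀ > 0 and ρ₁₂ > 0 satisfy ν₀ + ρ₀² + b ρ₁₂² = 0 and ν₁₂ + c ρ₀² − ρ₁₂² = 0, so that (ρ₀, ρ₁₂) is the interior equilibrium Ẽ₄. Then the Jacobian of the planar system at (ρ₀, ρ₁₂), namely [[2ρ₀², 2bρ₀ρ₁₂], [2cρ₀ρ₁₂, −2ρ₁₂²]], has a pair of nonzero purely imaginary complex eigenvalues if and only if ν₁₂ = (c − 1)ν₀/(b + 1). -/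
open Matrix

theorem Matrix.mem_spectrum_fin_two_iff {K : Type*} [Field K] (A : Matrix (Fin 2) (Fin 2) K)
    (z : K) : z ∈ spectrum K A ↔ z ^ 2 - A.trace * z + A.det = 0 := by
  rw [Matrix.mem_spectrum_iff_isRoot_charpoly, Matrix.charpoly_fin_two]
  simp [Polynomial.IsRoot]

/-- A real `2 × 2` matrix with positive determinant has a pair of nonzero purely imaginary
eigenvalues iff its trace vanishes. -/
theorem Matrix.exists_spectrum_eq_imaginary_pair_iff (A : Matrix (Fin 2) (Fin 2) ℝ)
    (hA : 0 < A.det) :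
    (∃ ω : ℝ, ω ≠ 0 ∧
        spectrum ℂ (A.map Complex.ofReal) = {Complex.I * (ω : ℝ), -(Complex.I * (ω : ℝ))}) ↔
      A.trace = 0 := by
  have htr : (A.map Complex.ofReal).trace = (A.trace : ℂ) := by
    simp [Matrix.trace_fin_two]
  have hdet : (A.map Complex.ofReal).det = (A.det : ℂ) := by
    simp [Matrix.det_fin_two]
  constructor
  · rintro ⟨ω, hω, h⟩
    have h₁ : Complex.I * (ω : ℂ) ∈ spectrum ℂ (A.map Complex.ofReal) := by simp [h]
    have h₂ : -(Complex.I * (ω : ℂ)) ∈ spectrum ℂ (A.map Complex.ofReal) := by simp [h]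
    rw [Matrix.mem_spectrum_fin_two_iff, htr, hdet] at h₁ h₂
    have h₃ : (A.trace : ℂ) * (2 * (Complex.I * ω)) = 0 := by linear_combination h₂ - h₁
    simpa [hω] using h₃
  · intro h
    refine ⟨√A.det, (Real.sqrt_pos.2 hA).ne', ?_⟩
    ext z
    have hs : ((√A.det : ℝ) : ℂ) ^ 2 = (A.det : ℂ) := by
      exact_mod_cast Real.sq_sqrt hA.le
    rw [Matrix.mem_spectrum_fin_two_iff, htr, hdet, h, Complex.ofReal_zero,
      Set.mem_insert_iff, Set.mem_singleton_iff, ← sq_eq_sq_iff_eq_or_eq_neg, mul_pow, hs, Complex.I_sq]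
    constructor <;> intro hz
    · linear_combination hz
    · linear_combination hz

/-- Hopf instability of the interior equilibrium `Ẽ₄` of the planar Hopf–Hopf amplitude
system in case VIa (`d = −1`, `b > 0`, `c < 0`, `−1 − bc > 0`): the Jacobian at `Ẽ₄` has a
pair of nonzero purely imaginary eigenvalues iff `ν₁₂ = (c − 1)ν₀/(b + 1)`. -/
theorem planar_hopf_condition_E4 (ν₀ ν12 b c : ℝ)
    (hb : 0 < b) (hc : c < 0) (hΔ : 0 < -1 - b * c)
    (ρ₀ ρ12 : ℝ) (hρ₀ : 0 < ρ₀) (hρ12 : 0 < ρ12)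
    (he1 : ν₀ + ρ₀ ^ 2 + b * ρ12 ^ 2 = 0)
    (he2 : ν12 + c * ρ₀ ^ 2 - ρ12 ^ 2 = 0) :
    (∃ ω : ℝ, ω ≠ 0 ∧
        spectrum ℂ
            ((!![2 * ρ₀ ^ 2, 2 * b * ρ₀ * ρ12;
                 2 * c * ρ₀ * ρ12, -2 * ρ12 ^ 2] : Matrix (Fin 2) (Fin 2) ℝ).map
              Complex.ofReal) =
          {Complex.I * (ω : ℝ), -(Complex.I * (ω : ℝ))}) ↔
      ν12 = (c - 1) * ν₀ / (b + 1) := by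
  have hdet : 0 < (!![2 * ρ₀ ^ 2, 2 * b * ρ₀ * ρ12;
      2 * c * ρ₀ * ρ12, -2 * ρ12 ^ 2] : Matrix (Fin 2) (Fin 2) ℝ).det := by
    rw [Matrix.det_fin_two_of]
    have : 0 < 4 * ρ₀ ^ 2 * ρ12 ^ 2 * (-1 - b * c) := by positivity
    linarith
  rw [Matrix.exists_spectrum_eq_imaginary_pair_iff _ hdet, Matrix.trace_fin_two_of,
    eq_div_iff (by positivity)]
  constructor
  · intro h
    linear_combination (b + 1) * he2 - (c - 1) * he1 - (1 + b * c) / 2 * h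
  · intro h
    have h' : (-1 - b * c) * (2 * ρ₀ ^ 2 + -2 * ρ12 ^ 2) = 0 := by
      linear_combination 2 * h - 2 * (b + 1) * he2 + 2 * (c - 1) * he1
    exact (mul_eq_zero.1 h').resolve_left hΔ.ne'
end

section
/- Assume σ₁ = 1, σ₂ = −1, d₀₂ > 0, d₂₀ < 0 and Δ̂ := σ₁σ₂ − d₀₂d₂₀ > 0 (case VIa). Let r₀ > 0 and z₂ ≠ 0 satisfy μ₀ + r₀² + d₀₂ z₂² = 0 and μ₂ + d₂₀ r₀² − z₂² = 0, so that (r₀, 0, z₂) is an equilibrium of system (24) (a 0:2 mixed mode). Then: (i) the Jacobian of (24) at (r₀, 0, z₂) has a pair of nonzero purely imaginary complex eigenvalues if and only if μ₀ = (d₀₂ + σ₁) μ₂/(d₂₀ + σ₂) = (d₀₂ + 1) μ₂/(d₂₀ − 1); (ii) if moreover μ₁ = −(d₁₀ r₀² + d₁₂ z₂² + z₂), then the multiset of complex eigenvalues of the Jacobian is {0, iω, −iω} for some ω > 0 (Hopf–zero singularity). -/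
open Polynomial

/-- The characteristic polynomial of a `3 × 3` matrix whose middle coordinate decouples. -/
theorem charpoly_of_middle_decoupled {R : Type*} [CommRing R] (a b c d l : R) :
    (!![a, 0, b; 0, l, 0; c, 0, d] : Matrix (Fin 3) (Fin 3) R).charpoly =
      (X - C l) * (X ^ 2 - C (a + d) * X + C (a * d - b * c)) := by
  simp [Matrix.charpoly, Matrix.det_fin_three]
  ring

/-- The linearization of system (24) at a point of the invariant plane `z₁ = 0`. -/
theorem jacobianMatrix_NF24_of_z1_eq_zero
    (μ₀ μ₁ μ₂ d01 d02 d10 d11 d12 d20 d21 s1 s2 s3 r0 z2 : ℝ) :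
    jacobianMatrix (NF24 μ₀ μ₁ μ₂ d01 d02 d10 d11 d12 d20 d21 s1 s2 s3) ![r0, 0, z2] =
      !![μ₀ + 3 * s1 * r0 ^ 2 + d02 * z2 ^ 2, 0, 2 * d02 * r0 * z2;
        0, μ₁ + d10 * r0 ^ 2 + d12 * z2 ^ 2 + z2, 0;
        2 * d20 * r0 * z2, 0, μ₂ + d20 * r0 ^ 2 + 3 * s2 * z2 ^ 2] := by
  have hF : HasFDerivAt (NF24 μ₀ μ₁ μ₂ d01 d02 d10 d11 d12 d20 d21 s1 s2 s3)
      (ContinuousLinearMap.pi fun i : Fin 3 => ∑ j : Fin 3,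
        (!![μ₀ + 3 * s1 * r0 ^ 2 + d02 * z2 ^ 2, 0, 2 * d02 * r0 * z2;
        0, μ₁ + d10 * r0 ^ 2 + d12 * z2 ^ 2 + z2, 0;
        2 * d20 * r0 * z2, 0, μ₂ + d20 * r0 ^ 2 + 3 * s2 * z2 ^ 2] :
          Matrix (Fin 3) (Fin 3) ℝ) i j •
            ContinuousLinearMap.proj (R := ℝ) (φ := fun _ : Fin 3 => ℝ) j)
      ![r0, 0, z2] := by
    have h (j : Fin 3) : HasFDerivAt (fun p : Fin 3 → ℝ => p j)
        (ContinuousLinearMap.proj (R := ℝ) (φ := fun _ : Fin 3 => ℝ) j) ![r0, 0, z2] :=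
      hasFDerivAt_apply j _
    have hq (m a b c : ℝ) := ((((h 0).pow 2).const_mul a).const_add m |>.add
      (((h 1).pow 2).const_mul b)).add (((h 2).pow 2).const_mul c)
    rw [hasFDerivAt_pi']
    intro i
    fin_cases i
    · refine ((hq μ₀ s1 d01 d02).mul (h 0)).congr_fderiv ?_
      ext v
      simp [Fin.sum_univ_three]
      ring
    · refine (((hq μ₁ d10 d11 d12).mul (h 1)).add ((h 1).mul (h 2))).congr_fderiv ?_
      ext v
      simp [Fin.sum_univ_three]
      ring
    · refine (((hq μ₂ d20 d21 s2).mul (h 2)).add (((h 1).pow 2).const_mul s3)).congr_fderiv ?_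
      ext v
      simp [Fin.sum_univ_three]
      ring
  ext i j
  rw [jacobianMatrix, hF.fderiv]
  simp [Pi.single_apply]

/-- Hopf and Hopf–zero instability at a 0:2 mixed-mode equilibrium `(r₀, 0, z₂)` of system
(24) in case VIa (`σ₁ = 1`, `σ₂ = −1`, `d₀₂ > 0`, `d₂₀ < 0`, `Δ̂ = −1 − d₀₂ d₂₀ > 0`). -/
theorem hopf_zero_at_mixed_mode_02 (μ₀ μ₁ μ₂ d01 d02 d10 d11 d12 d20 d21 s3 : ℝ)
    (hs3 : s3 = 1 ∨ s3 = -1)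
    (hd02 : 0 < d02) (hd20 : d20 < 0) (hΔ : 0 < -1 - d02 * d20)
    (r0 z2 : ℝ) (hr0 : 0 < r0) (hz2 : z2 ≠ 0)
    (he1 : μ₀ + r0 ^ 2 + d02 * z2 ^ 2 = 0)
    (he2 : μ₂ + d20 * r0 ^ 2 - z2 ^ 2 = 0) :
    let J : Matrix (Fin 3) (Fin 3) ℝ :=
      jacobianMatrix (NF24 μ₀ μ₁ μ₂ d01 d02 d10 d11 d12 d20 d21 1 (-1) s3) ![r0, 0, z2]
    ((∃ ω : ℝ, ω ≠ 0 ∧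
        Complex.I * (ω : ℝ) ∈ spectrum ℂ (J.map Complex.ofReal) ∧
        -(Complex.I * (ω : ℝ)) ∈ spectrum ℂ (J.map Complex.ofReal)) ↔
      μ₀ = (d02 + 1) * μ₂ / (d20 - 1)) ∧
    (μ₀ = (d02 + 1) * μ₂ / (d20 - 1) →
      μ₁ = -(d10 * r0 ^ 2 + d12 * z2 ^ 2 + z2) →
      ∃ ω : ℝ, 0 < ω ∧
        (J.map Complex.ofReal).charpoly.roots =
          {(0 : ℂ), Complex.I * (ω : ℝ), -(Complex.I * (ω : ℝ))}) := by
  intro J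
  have hJ : (J.map Complex.ofReal).charpoly =
      (X - C ((μ₁ + d10 * r0 ^ 2 + d12 * z2 ^ 2 + z2 : ℝ) : ℂ)) *
        (X ^ 2 - C ((2 * (r0 ^ 2 - z2 ^ 2) : ℝ) : ℂ) * X +
          C ((4 * r0 ^ 2 * z2 ^ 2 * (-1 - d02 * d20) : ℝ) : ℂ)) := by
    have hJ' : J = !![2 * r0 ^ 2, 0, 2 * d02 * r0 * z2;
        0, μ₁ + d10 * r0 ^ 2 + d12 * z2 ^ 2 + z2, 0;
        2 * d20 * r0 * z2, 0, -2 * z2 ^ 2] := by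
      rw [show J = _ from jacobianMatrix_NF24_of_z1_eq_zero ..,
        show μ₀ + 3 * 1 * r0 ^ 2 + d02 * z2 ^ 2 = 2 * r0 ^ 2 by linarith,
        show μ₂ + d20 * r0 ^ 2 + 3 * -1 * z2 ^ 2 = -2 * z2 ^ 2 by linarith]
    have hmap : (J.map Complex.ofReal).charpoly = J.charpoly.map Complex.ofRealHom :=
      Matrix.charpoly_map J Complex.ofRealHom
    rw [hmap, hJ', charpoly_of_middle_decoupled,
      show 2 * r0 ^ 2 + -2 * z2 ^ 2 = 2 * (r0 ^ 2 - z2 ^ 2) by ring,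
      show 2 * r0 ^ 2 * (-2 * z2 ^ 2) - 2 * d02 * r0 * z2 * (2 * d20 * r0 * z2) =
        4 * r0 ^ 2 * z2 ^ 2 * (-1 - d02 * d20) by ring]
    simp only [Polynomial.map_mul, Polynomial.map_add, Polynomial.map_sub, Polynomial.map_pow,
      map_X, map_C, Complex.ofRealHom_eq_coe]
  have hμ : μ₀ = (d02 + 1) * μ₂ / (d20 - 1) ↔ r0 ^ 2 = z2 ^ 2 := by
    have h0 : μ₀ = -r0 ^ 2 - d02 * z2 ^ 2 := by linarith
    have h2 : μ₂ = z2 ^ 2 - d20 * r0 ^ 2 := by linarith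
    rw [eq_div_iff (by linarith), ← sub_eq_zero, ← sub_eq_zero (a := r0 ^ 2),
      show μ₀ * (d20 - 1) - (d02 + 1) * μ₂ = -(-1 - d02 * d20) * (r0 ^ 2 - z2 ^ 2) by
        rw [h0, h2]; ring]
    simp [hΔ.ne', -neg_sub]
  have hD : 0 < 4 * r0 ^ 2 * z2 ^ 2 * (-1 - d02 * d20) := by positivity
  obtain ⟨ω, hω, hωD⟩ : ∃ ω : ℝ, 0 < ω ∧ 4 * r0 ^ 2 * z2 ^ 2 * (-1 - d02 * d20) = ω ^ 2 :=
    ⟨_, Real.sqrt_pos.2 hD, (Real.sq_sqrt hD.le).symm⟩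
  have hfactor (h : r0 ^ 2 = z2 ^ 2) : (J.map Complex.ofReal).charpoly =
      (X - C ((μ₁ + d10 * r0 ^ 2 + d12 * z2 ^ 2 + z2 : ℝ) : ℂ)) *
        ((X - C (Complex.I * ω)) * (X - C (-(Complex.I * ω)))) := by
    have hI : (C Complex.I : ℂ[X]) ^ 2 = -1 := by rw [← C_pow, Complex.I_sq]; simp
    rw [hJ, hωD, h, sub_self, mul_zero]
    simp only [Complex.ofReal_zero, Complex.ofReal_pow, C_0, C_neg, C_mul, C_pow]
    linear_combination (X - C ((μ₁ + d10 * z2 ^ 2 + d12 * z2 ^ 2 + z2 : ℝ) : ℂ)) *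
      C (ω : ℂ) ^ 2 * hI
  rw [hμ]
  refine ⟨⟨?_, fun h => ⟨ω, hω.ne', ?_, ?_⟩⟩, fun h hμ₁ => ⟨ω, hω, ?_⟩⟩
  · rintro ⟨w, hw, hmem, -⟩
    rw [Matrix.mem_spectrum_iff_isRoot_charpoly, hJ, IsRoot.def, eval_mul, mul_eq_zero] at hmem
    rcases hmem with hmem | hmem
    · have := congrArg Complex.im hmem
      simp [-Complex.ofReal_pow] at this
      exact absurd this hw
    · have := congrArg Complex.im hmem
      simp [← Complex.ofReal_pow, mul_pow] at this
      exact sub_eq_zero.1 (this.resolve_right hw)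
  · rw [Matrix.mem_spectrum_iff_isRoot_charpoly, hfactor h]
    simp
  · rw [Matrix.mem_spectrum_iff_isRoot_charpoly, hfactor h]
    simp
  · rw [hfactor h, hμ₁]
    have hL : -(d10 * r0 ^ 2 + d12 * z2 ^ 2 + z2) + d10 * r0 ^ 2 + d12 * z2 ^ 2 + z2 = 0 := by ring
    rw [hL, Complex.ofReal_zero,
      show ({(0 : ℂ), Complex.I * (ω : ℝ), -(Complex.I * (ω : ℝ))} : Multiset ℂ) =
        {0} + ({Complex.I * (ω : ℝ)} + {-(Complex.I * (ω : ℝ))}) from rfl,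
      roots_mul (mul_ne_zero (X_sub_C_ne_zero _)
        (mul_ne_zero (X_sub_C_ne_zero _) (X_sub_C_ne_zero _))),
      roots_mul (mul_ne_zero (X_sub_C_ne_zero _) (X_sub_C_ne_zero _)),
      roots_X_sub_C, roots_X_sub_C, roots_X_sub_C]
end

section
/- (Quadratic near-identity normalization.) Let λ, μ₁, μ₂ ∈ ℂ and, for j = 0, 1, 2 and nonnegative integers p, q, r, s with p + q + r + s = 2, let F^j_{pqrs} ∈ ℂ. Define V : ℂ³ → ℂ³ by V(z, α₁, α₂) = (λz + Σ F⁰_{pqrs} zᵖ z̄^q α₁ʳ α₂ˢ, μ₁α₁ + Σ F¹_{pqrs} zᵖ z̄^q α₁ʳ α₂ˢ, μ₂α₂ + Σ F²_{pqrs} zᵖ z̄^q α₁ʳ α₂ˢ), where each sum runs over p + q + r + s = 2. Let R⁰ := {(1,0,1,0), (1,0,0,1)} and R¹ = R² := {(1,1,0,0), (0,0,2,0), (0,0,1,1), (0,0,0,2)}, and assume the non-resonance conditions: λ(p−1) + λ̄q + μ₁r + μ₂s ≠ 0 for every quadruple with p+q+r+s = 2 not in R⁰; λp + λ̄q + μ₁(r−1)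 + μ₂s ≠ 0 for every quadruple not in R¹; and λp + λ̄q + μ₁r + μ₂(s−1) ≠ 0 for every quadruple not in R². Then there exist complex coefficients Γ_{pqrs}, Θ_{pqrs}, Λ_{pqrs} (for p+q+r+s = 2) such that, setting φ(ζ, x, y) := (ζ + Σ Γ_{pqrs} ζᵖ ζ̄^q xʳ yˢ, x + Σ Θ_{pqrs} ζᵖ ζ̄^q xʳ yˢ, y + Σ Λ_{pqrs} ζᵖ ζ̄^q xʳ yˢ) and W(ζ, x, y) := (λζ + F⁰₁₀₁₀ ζx + F⁰₁₀₀₁ ζy, μ₁x + F¹₁₁₀₀|ζ|² + F¹₀₀₂₀x² + F¹₀₀₁₁xy + F¹₀₀₀₂y², μ₂y + F²₁₁₀₀|ζ|² + F²₀₀₂₀x² + F²₀₀₁₁xy + F²₀₀₀₂y²), there exist constants C, δ > 0 with ‖V(φ(w)) − Dφ(w)·W(w)‖ ≤ C‖w‖³ for all w ∈ ℂ³ with ‖w‖ < δ, where Dφ(w) is the ℝ-linear Fréchet derivative of φ (viewing ℂ³ as ℝ⁶). -/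
/-- The sum of all quadratic monomials `F p q r s · zᵖ z̄^q α₁ʳ α₂ˢ` with `p+q+r+s = 2`. -/
noncomputable def quadSum (F : ℕ → ℕ → ℕ → ℕ → ℂ) (z a1 a2 : ℂ) : ℂ :=
  ∑ p ∈ Finset.range 3, ∑ q ∈ Finset.range 3, ∑ r ∈ Finset.range 3, ∑ s ∈ Finset.range 3,
    if p + q + r + s = 2 then
      F p q r s * z ^ p * (starRingEnd ℂ z) ^ q * a1 ^ r * a2 ^ s
    else 0

/-- The vector field `V` with linear part `diag(λ, μ₁, μ₂)` and general quadratic part. -/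
noncomputable def Vquad (lam μ₁ μ₂ : ℂ) (F0 F1 F2 : ℕ → ℕ → ℕ → ℕ → ℂ)
    (w : ℂ × ℂ × ℂ) : ℂ × ℂ × ℂ :=
  (lam * w.1 + quadSum F0 w.1 w.2.1 w.2.2,
   μ₁ * w.2.1 + quadSum F1 w.1 w.2.1 w.2.2,
   μ₂ * w.2.2 + quadSum F2 w.1 w.2.1 w.2.2)

/-- The near-identity quadratic change of coordinates. -/
noncomputable def phiQuad (Γ Θ Λ' : ℕ → ℕ → ℕ → ℕ → ℂ) (w : ℂ × ℂ × ℂ) : ℂ × ℂ × ℂ :=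
  (w.1 + quadSum Γ w.1 w.2.1 w.2.2,
   w.2.1 + quadSum Θ w.1 w.2.1 w.2.2,
   w.2.2 + quadSum Λ' w.1 w.2.1 w.2.2)

/-- The vector field `W` retaining only the resonant quadratic monomials. -/
noncomputable def Wquad (lam μ₁ μ₂ : ℂ) (F0 F1 F2 : ℕ → ℕ → ℕ → ℕ → ℂ)
    (w : ℂ × ℂ × ℂ) : ℂ × ℂ × ℂ :=
  (lam * w.1 + F0 1 0 1 0 * w.1 * w.2.1 + F0 1 0 0 1 * w.1 * w.2.2,
   μ₁ * w.2.1 + F1 1 1 0 0 * (w.1 * starRingEnd ℂ w.1) + F1 0 0 2 0 * w.2.1 ^ 2 +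
     F1 0 0 1 1 * w.2.1 * w.2.2 + F1 0 0 0 2 * w.2.2 ^ 2,
   μ₂ * w.2.2 + F2 1 1 0 0 * (w.1 * starRingEnd ℂ w.1) + F2 0 0 2 0 * w.2.1 ^ 2 +
     F2 0 0 1 1 * w.2.1 * w.2.2 + F2 0 0 0 2 * w.2.2 ^ 2)

/-- A change of coordinates `w ↦ w + BQ w w` which solves the homological equation conjugates
`L + BF` to `L + BR` up to a cubic remainder. -/
lemma exists_cubic_bound_of_homological {E : Type*} [NormedAddCommGroup E] [NormedSpace ℝ E]
    (L : E → E) (BF BQ BR : E →L[ℝ] E →L[ℝ] E) (hL : ∀ x y, L (x + y) = L x + L y)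
    (hom : ∀ w, L (BQ w w) + BF w w = BR w w + (BQ w (L w) + BQ (L w) w)) :
    ∃ C : ℝ, 0 < C ∧ ∀ w : E, ‖w‖ < 1 →
      ‖(L (w + BQ w w) + BF (w + BQ w w) (w + BQ w w)) -
        fderiv ℝ (fun w ↦ w + BQ w w) w (L w + BR w w)‖ ≤ C * ‖w‖ ^ 3 := by
  refine ⟨2 * ‖BF‖ * ‖BQ‖ + ‖BF‖ * ‖BQ‖ ^ 2 + 2 * ‖BQ‖ * ‖BR‖ + 1, by positivity, fun w hw ↦ ?_⟩
  have hd : HasFDerivAt (fun w ↦ w + BQ w w)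
      (ContinuousLinearMap.id ℝ E + (BQ w + BQ.flip w)) w := by
    refine (hasFDerivAt_id w).add ?_
    refine (BQ.hasFDerivAt_of_bilinear (hasFDerivAt_id w) (hasFDerivAt_id w)).congr_fderiv ?_
    ext h
    simp
  have key : (L (w + BQ w w) + BF (w + BQ w w) (w + BQ w w)) -
        fderiv ℝ (fun w ↦ w + BQ w w) w (L w + BR w w) =
      BF w (BQ w w) + BF (BQ w w) w + BF (BQ w w) (BQ w w) - BQ w (BR w w) - BQ (BR w w) w := by
    have h := sub_eq_zero.mpr (hom w)
    rw [hd.fderiv, hL, ← sub_eq_zero, ← h]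
    simp only [map_add, add_apply, ContinuousLinearMap.id_apply,
      ContinuousLinearMap.flip_apply]
    abel
  have hQ : ‖BQ w w‖ ≤ ‖BQ‖ * ‖w‖ * ‖w‖ := BQ.le_opNorm₂ w w
  have hR : ‖BR w w‖ ≤ ‖BR‖ * ‖w‖ * ‖w‖ := BR.le_opNorm₂ w w
  have h1 : ‖BF w (BQ w w)‖ ≤ ‖BF‖ * ‖BQ‖ * ‖w‖ ^ 3 :=
    calc _ ≤ ‖BF‖ * ‖w‖ * ‖BQ w w‖ := BF.le_opNorm₂ _ _
      _ ≤ ‖BF‖ * ‖w‖ * (‖BQ‖ * ‖w‖ * ‖w‖) := by gcongr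
      _ = _ := by ring
  have h2 : ‖BF (BQ w w) w‖ ≤ ‖BF‖ * ‖BQ‖ * ‖w‖ ^ 3 :=
    calc _ ≤ ‖BF‖ * ‖BQ w w‖ * ‖w‖ := BF.le_opNorm₂ _ _
      _ ≤ ‖BF‖ * (‖BQ‖ * ‖w‖ * ‖w‖) * ‖w‖ := by gcongr
      _ = _ := by ring
  have h3 : ‖BF (BQ w w) (BQ w w)‖ ≤ ‖BF‖ * ‖BQ‖ ^ 2 * ‖w‖ ^ 3 :=
    calc _ ≤ ‖BF‖ * ‖BQ w w‖ * ‖BQ w w‖ := BF.le_opNorm₂ _ _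
      _ ≤ ‖BF‖ * (‖BQ‖ * ‖w‖ * ‖w‖) * (‖BQ‖ * ‖w‖ * ‖w‖) := by gcongr
      _ = ‖BF‖ * ‖BQ‖ ^ 2 * ‖w‖ ^ 3 * ‖w‖ := by ring
      _ ≤ _ := mul_le_of_le_one_right (by positivity) hw.le
  have h4 : ‖BQ w (BR w w)‖ ≤ ‖BQ‖ * ‖BR‖ * ‖w‖ ^ 3 :=
    calc _ ≤ ‖BQ‖ * ‖w‖ * ‖BR w w‖ := BQ.le_opNorm₂ _ _
      _ ≤ ‖BQ‖ * ‖w‖ * (‖BR‖ * ‖w‖ * ‖w‖) := by gcongr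
      _ = _ := by ring
  have h5 : ‖BQ (BR w w) w‖ ≤ ‖BQ‖ * ‖BR‖ * ‖w‖ ^ 3 :=
    calc _ ≤ ‖BQ‖ * ‖BR w w‖ * ‖w‖ := BQ.le_opNorm₂ _ _
      _ ≤ ‖BQ‖ * (‖BR‖ * ‖w‖ * ‖w‖) * ‖w‖ := by gcongr
      _ = _ := by ring
  have h6 : 0 ≤ ‖w‖ ^ 3 := by positivity
  rw [key]
  refine (norm_sub_le_of_le (norm_sub_le_of_le
    (norm_add_le_of_le (norm_add_le_of_le h1 h2) h3) h4) h5).trans ?_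
  linarith

/-- A quadratic form in `z, z̄, α₁, α₂` is the diagonal of a continuous real bilinear map. -/
lemma exists_bilin_quadSum (F : ℕ → ℕ → ℕ → ℕ → ℂ) :
    ∃ B : (ℂ × ℂ × ℂ) →L[ℝ] (ℂ × ℂ × ℂ) →L[ℝ] ℂ,
      ∀ w, B w w = quadSum F w.1 w.2.1 w.2.2 := by
  let z : (ℂ × ℂ × ℂ) →L[ℝ] ℂ := .fst ℝ ℂ (ℂ × ℂ)
  let zbar : (ℂ × ℂ × ℂ) →L[ℝ] ℂ := Complex.conjCLE.toContinuousLinearMap.comp z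
  let x : (ℂ × ℂ × ℂ) →L[ℝ] ℂ := (ContinuousLinearMap.fst ℝ ℂ ℂ).comp (.snd ℝ ℂ (ℂ × ℂ))
  let y : (ℂ × ℂ × ℂ) →L[ℝ] ℂ := (ContinuousLinearMap.snd ℝ ℂ ℂ).comp (.snd ℝ ℂ (ℂ × ℂ))
  let m (f g : (ℂ × ℂ × ℂ) →L[ℝ] ℂ) : (ℂ × ℂ × ℂ) →L[ℝ] (ℂ × ℂ × ℂ) →L[ℝ] ℂ :=
    (ContinuousLinearMap.mul ℝ ℂ).bilinearComp f g
  refine ⟨F 2 0 0 0 • m z z + F 0 2 0 0 • m zbar zbar + F 0 0 2 0 • m x x + F 0 0 0 2 • m y y +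
    F 1 1 0 0 • m z zbar + F 1 0 1 0 • m z x + F 1 0 0 1 • m z y + F 0 1 1 0 • m zbar x +
    F 0 1 0 1 • m zbar y + F 0 0 1 1 • m x y, fun w ↦ ?_⟩
  simp [quadSum, Finset.sum_range_succ, m, z, zbar, x, y]
  ring

lemma exists_bilin_quadSum_prod (F0 F1 F2 : ℕ → ℕ → ℕ → ℕ → ℂ) :
    ∃ B : (ℂ × ℂ × ℂ) →L[ℝ] (ℂ × ℂ × ℂ) →L[ℝ] (ℂ × ℂ × ℂ), ∀ w, B w w =
      (quadSum F0 w.1 w.2.1 w.2.2, quadSum F1 w.1 w.2.1 w.2.2,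
        quadSum F2 w.1 w.2.1 w.2.2) := by
  obtain ⟨B0, h0⟩ := exists_bilin_quadSum F0
  obtain ⟨B1, h1⟩ := exists_bilin_quadSum F1
  obtain ⟨B2, h2⟩ := exists_bilin_quadSum F2
  let i0 : ℂ →L[ℝ] ℂ × ℂ × ℂ := .inl ℝ ℂ (ℂ × ℂ)
  let i1 : ℂ →L[ℝ] ℂ × ℂ × ℂ := (ContinuousLinearMap.inr ℝ ℂ (ℂ × ℂ)).comp (.inl ℝ ℂ ℂ)
  let i2 : ℂ →L[ℝ] ℂ × ℂ × ℂ := (ContinuousLinearMap.inr ℝ ℂ (ℂ × ℂ)).comp (.inr ℝ ℂ ℂ)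
  let c := ContinuousLinearMap.compL ℝ (ℂ × ℂ × ℂ) ℂ (ℂ × ℂ × ℂ)
  refine ⟨(c i0).comp B0 + (c i1).comp B1 + (c i2).comp B2, fun w ↦ ?_⟩
  simp [c, i0, i1, i2, h0, h1, h2]

/-- The polarization of a quadratic form at `w` and `diag(λ, μ₁, μ₂) w`. -/
lemma quadSum_polar (lam μ₁ μ₂ : ℂ) (G : ℕ → ℕ → ℕ → ℕ → ℂ) (z x y : ℂ) :
    quadSum G (z + lam * z) (x + μ₁ * x) (y + μ₂ * y) - quadSum G z x y -
        quadSum G (lam * z) (μ₁ * x) (μ₂ * y) =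
      quadSum (fun p q r s ↦
        (lam * p + starRingEnd ℂ lam * q + μ₁ * r + μ₂ * s) * G p q r s) z x y := by
  simp [quadSum, Finset.sum_range_succ]
  ring

/-- The scalar homological equation is solvable off the resonant set `S`. -/
lemma exists_quadSum_homological (lam μ₁ μ₂ ν : ℂ) (F : ℕ → ℕ → ℕ → ℕ → ℂ)
    (S : Set (ℕ × ℕ × ℕ × ℕ)) [DecidablePred (· ∈ S)]
    (hnr : ∀ p q r s : ℕ, p + q + r + s = 2 → (p, q, r, s) ∉ S →
      lam * p + starRingEnd ℂ lam * q + μ₁ * r + μ₂ * s - ν ≠ 0) :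
    ∃ G : ℕ → ℕ → ℕ → ℕ → ℂ, ∀ z x y : ℂ,
      ν * quadSum G z x y + quadSum F z x y =
        quadSum (fun p q r s ↦ if (p, q, r, s) ∈ S then F p q r s else 0) z x y +
        (quadSum G (z + lam * z) (x + μ₁ * x) (y + μ₂ * y) - quadSum G z x y -
          quadSum G (lam * z) (μ₁ * x) (μ₂ * y)) := by
  refine ⟨fun p q r s ↦ if (p, q, r, s) ∈ S then 0 else
    F p q r s / (lam * p + starRingEnd ℂ lam * q + μ₁ * r + μ₂ * s - ν), fun z x y ↦ ?_⟩
  rw [quadSum_polar]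
  simp only [quadSum, Finset.mul_sum, ← Finset.sum_add_distrib]
  refine Finset.sum_congr rfl fun p _ ↦ Finset.sum_congr rfl fun q _ ↦
    Finset.sum_congr rfl fun r _ ↦ Finset.sum_congr rfl fun s _ ↦ ?_
  by_cases h : p + q + r + s = 2
  · by_cases hS : (p, q, r, s) ∈ S
    · simp [h, hS]
    · have := hnr p q r s h hS
      simp only [h, hS, if_true, if_false]
      field_simp
      ring
  · simp [h]

/-- Quadratic near-identity normalization: under the non-resonance conditions there is a
near-identity quadratic change of coordinates `φ` conjugating `V` to the resonant normal
form `W` up to a remainder of order `‖w‖³`. -/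
theorem quadratic_near_identity_normalization (lam μ₁ μ₂ : ℂ)
    (F0 F1 F2 : ℕ → ℕ → ℕ → ℕ → ℂ)
    (hnr0 : ∀ p q r s : ℕ, p + q + r + s = 2 →
      (p, q, r, s) ∉ ({(1, 0, 1, 0), (1, 0, 0, 1)} : Set (ℕ × ℕ × ℕ × ℕ)) →
      lam * ((p : ℂ) - 1) + (starRingEnd ℂ lam) * (q : ℂ) + μ₁ * (r : ℂ) + μ₂ * (s : ℂ) ≠ 0)
    (hnr1 : ∀ p q r s : ℕ, p + q + r + s = 2 →
      (p, q, r, s) ∉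
        ({(1, 1, 0, 0), (0, 0, 2, 0), (0, 0, 1, 1), (0, 0, 0, 2)} : Set (ℕ × ℕ × ℕ × ℕ)) →
      lam * (p : ℂ) + (starRingEnd ℂ lam) * (q : ℂ) + μ₁ * ((r : ℂ) - 1) + μ₂ * (s : ℂ) ≠ 0)
    (hnr2 : ∀ p q r s : ℕ, p + q + r + s = 2 →
      (p, q, r, s) ∉
        ({(1, 1, 0, 0), (0, 0, 2, 0), (0, 0, 1, 1), (0, 0, 0, 2)} : Set (ℕ × ℕ × ℕ × ℕ)) →
      lam * (p : ℂ) + (starRingEnd ℂ lam) * (q : ℂ) + μ₁ * (r : ℂ) + μ₂ * ((s : ℂ) - 1) ≠ 0) :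
    ∃ Γ Θ Λ' : ℕ → ℕ → ℕ → ℕ → ℂ, ∃ C δ : ℝ, 0 < C ∧ 0 < δ ∧
      ∀ w : ℂ × ℂ × ℂ, ‖w‖ < δ →
        ‖Vquad lam μ₁ μ₂ F0 F1 F2 (phiQuad Γ Θ Λ' w) -
            fderiv ℝ (phiQuad Γ Θ Λ') w (Wquad lam μ₁ μ₂ F0 F1 F2 w)‖ ≤ C * ‖w‖ ^ 3 := by
  classical
  obtain ⟨Γ, hΓ⟩ := exists_quadSum_homological lam μ₁ μ₂ lam F0 {(1, 0, 1, 0), (1, 0, 0, 1)}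
    fun p q r s h hS e ↦ hnr0 p q r s h hS (by linear_combination e)
  obtain ⟨Θ, hΘ⟩ := exists_quadSum_homological lam μ₁ μ₂ μ₁ F1
    {(1, 1, 0, 0), (0, 0, 2, 0), (0, 0, 1, 1), (0, 0, 0, 2)}
    fun p q r s h hS e ↦ hnr1 p q r s h hS (by linear_combination e)
  obtain ⟨Λ', hΛ⟩ := exists_quadSum_homological lam μ₁ μ₂ μ₂ F2
    {(1, 1, 0, 0), (0, 0, 2, 0), (0, 0, 1, 1), (0, 0, 0, 2)}
    fun p q r s h hS e ↦ hnr2 p q r s h hS (by linear_combination e)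
  obtain ⟨BF, hF⟩ := exists_bilin_quadSum_prod F0 F1 F2
  obtain ⟨BQ, hQ⟩ := exists_bilin_quadSum_prod Γ Θ Λ'
  obtain ⟨BR, hR⟩ := exists_bilin_quadSum_prod
    (fun p q r s ↦ if (p, q, r, s) ∈ ({(1, 0, 1, 0), (1, 0, 0, 1)} : Set (ℕ × ℕ × ℕ × ℕ))
      then F0 p q r s else 0)
    (fun p q r s ↦ if (p, q, r, s) ∈
      ({(1, 1, 0, 0), (0, 0, 2, 0), (0, 0, 1, 1), (0, 0, 0, 2)} : Set (ℕ × ℕ × ℕ × ℕ))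
      then F1 p q r s else 0)
    (fun p q r s ↦ if (p, q, r, s) ∈
      ({(1, 1, 0, 0), (0, 0, 2, 0), (0, 0, 1, 1), (0, 0, 0, 2)} : Set (ℕ × ℕ × ℕ × ℕ))
      then F2 p q r s else 0)
  let L : ℂ × ℂ × ℂ → ℂ × ℂ × ℂ := fun w ↦ (lam * w.1, μ₁ * w.2.1, μ₂ * w.2.2)
  have hV : Vquad lam μ₁ μ₂ F0 F1 F2 = fun w ↦ L w + BF w w := by
    funext w
    rw [hF]
    rfl
  have hφ : phiQuad Γ Θ Λ' = fun w ↦ w + BQ w w := by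
    funext w
    rw [hQ]
    rfl
  have hW : Wquad lam μ₁ μ₂ F0 F1 F2 = fun w ↦ L w + BR w w := by
    funext w
    rw [hR]
    refine Prod.ext ?_ (Prod.ext ?_ ?_) <;>
    · simp [Wquad, L, quadSum, Finset.sum_range_succ]
      ring
  have hom : ∀ w, L (BQ w w) + BF w w = BR w w + (BQ w (L w) + BQ (L w) w) := by
    intro w
    have hpolar : BQ w (L w) + BQ (L w) w =
        BQ (w + L w) (w + L w) - BQ w w - BQ (L w) (L w) := by
      simp only [map_add, add_apply]
      abel
    rw [hpolar, hF, hR, hQ, hQ, hQ]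
    exact Prod.ext (hΓ _ _ _) (Prod.ext (hΘ _ _ _) (hΛ _ _ _))
  obtain ⟨C, hC, hbound⟩ := exists_cubic_bound_of_homological L BF BQ BR
    (fun x y ↦ by simp [L, mul_add]) hom
  refine ⟨Γ, Θ, Λ', C, 1, hC, one_pos, fun w hw ↦ ?_⟩
  rw [hV, hφ, hW]
  exact hbound w hw
end

section
/- (Cubic near-identity normalization.) Let λ₀, μ₁, μ₂ ∈ ℂ and assume the ten numbers 2λ₀, 2λ̄₀, 3λ̄₀ − λ₀, λ̄₀ − λ₀ + 2μ₁, λ̄₀ − λ₀ + 2μ₂, 2μ₁ + μ₂ − λ₀, λ₀ + μ₂, λ̄₀ + μ₂, μ₂ − 2μ₁ − λ₀, μ₂ − 2μ₁ − λ̄₀ are all nonzero. Define V : ℂ³ → ℂ³ by V(z, α₁, α₂) = (λ₀z + Z₃₀₀₀z³ + Z₂₁₀₀|z|²z + Z₁₂₀₀|z|²z̄ + Z₀₃₀₀z̄³ + Z₁₀₂₀zα₁² + Z₀₁₂₀z̄α₁² + Z₁₀₀₂zα₂² + Z₀₁₀₂z̄α₂² + Z₀₀₂₁α₁²α₂, μ₁α₁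 + C₃α₁α₂ + X₂₀₁₀z²α₁ + X₁₁₁₀|z|²α₁ + X₀₂₁₀z̄²α₁ + X₁₀₁₁zα₁α₂ + X₀₁₁₁z̄α₁α₂ + X₀₀₃₀α₁³ + X₀₀₁₂α₁α₂², μ₂α₂ + D₁α₁² + Y₁₀₂₀zα₁² + Y₀₁₂₀z̄α₁² + Y₂₀₀₁z²α₂ + Y₁₁₀₁|z|²α₂ + Y₀₂₀₁z̄²α₂ + Y₀₀₂₁α₁²α₂ + Y₀₀₀₃α₂³), with all coefficients in ℂ. Then there exist complex coefficients Ξ₃₀₀₀, Ξ₁₂₀₀, Ξ₀₃₀₀, Ξ₀₁₂₀, Ξ₀₁₀₂, Ξ₀₀₂₁, Π₂₀₁₀, Π₀₂₁₀, Π₁₀₁₁, Π₀₁₁₁, Υ₁₀₂₀, Υ₀₁₂₀, Υ₂₀₀₁, Υ₀₂₀₁ such that, setting φ(ζ, x, y) := (ζ + Ξ₃₀₀₀ζ³ + Ξ₁₂₀₀ζζ̄² + Ξ₀₃₀₀ζ̄³ + Ξ₀₁₂₀ζ̄x² + Ξ₀₁₀₂ζ̄y² + Ξ₀₀₂₁x²y,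 x + Π₂₀₁₀ζ²x + Π₀₂₁₀ζ̄²x + Π₁₀₁₁ζxy + Π₀₁₁₁ζ̄xy, y + Υ₁₀₂₀ζx² + Υ₀₁₂₀ζ̄x² + Υ₂₀₀₁ζ²y + Υ₀₂₀₁ζ̄²y) and W(ζ, x, y) := (λ₀ζ + Z₂₁₀₀|ζ|²ζ + Z₁₀₂₀ζx² + Z₁₀₀₂ζy², μ₁x + C₃xy + X₁₁₁₀|ζ|²x + X₀₀₃₀x³ + X₀₀₁₂xy², μ₂y + D₁x² + Y₁₁₀₁|ζ|²y + Y₀₀₂₁x²y + Y₀₀₀₃y³), there exist constants C, δ > 0 with ‖V(φ(w)) − Dφ(w)·W(w)‖ ≤ C‖w‖⁴ for all w ∈ ℂ³ with ‖w‖ < δ, where Dφ(w) is the ℝ-linear Fréchet derivative of φ (viewing ℂ³ as ℝ⁶). In particular, the coefficients of the resonant cubic monomials retained in W coincide with the same-named coefficients of V. -/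
/-- The cubic vector field `V` (whose quadratic part contains only the resonant terms
`C₃α₁α₂` and `D₁α₁²`). -/
noncomputable def Vcubic (lam0 μ₁ μ₂
    Z3000 Z2100 Z1200 Z0300 Z1020 Z0120 Z1002 Z0102 Z0021 C3
    X2010 X1110 X0210 X1011 X0111 X0030 X0012 D1
    Y1020 Y0120 Y2001 Y1101 Y0201 Y0021 Y0003 : ℂ) (w : ℂ × ℂ × ℂ) : ℂ × ℂ × ℂ :=
  let z := w.1
  let a1 := w.2.1
  let a2 := w.2.2
  let zb := starRingEnd ℂ z
  (lam0 * z + Z3000 * z ^ 3 + Z2100 * (z * zb) * z + Z1200 * (z * zb) * zb +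
      Z0300 * zb ^ 3 + Z1020 * z * a1 ^ 2 + Z0120 * zb * a1 ^ 2 + Z1002 * z * a2 ^ 2 +
      Z0102 * zb * a2 ^ 2 + Z0021 * a1 ^ 2 * a2,
   μ₁ * a1 + C3 * a1 * a2 + X2010 * z ^ 2 * a1 + X1110 * (z * zb) * a1 +
      X0210 * zb ^ 2 * a1 + X1011 * z * a1 * a2 + X0111 * zb * a1 * a2 +
      X0030 * a1 ^ 3 + X0012 * a1 * a2 ^ 2,
   μ₂ * a2 + D1 * a1 ^ 2 + Y1020 * z * a1 ^ 2 + Y0120 * zb * a1 ^ 2 +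
      Y2001 * z ^ 2 * a2 + Y1101 * (z * zb) * a2 + Y0201 * zb ^ 2 * a2 +
      Y0021 * a1 ^ 2 * a2 + Y0003 * a2 ^ 3)

/-- The cubic near-identity change of coordinates. -/
noncomputable def phiCubic (Xi3000 Xi1200 Xi0300 Xi0120 Xi0102 Xi0021
    Pi2010 Pi0210 Pi1011 Pi0111 Up1020 Up0120 Up2001 Up0201 : ℂ)
    (w : ℂ × ℂ × ℂ) : ℂ × ℂ × ℂ :=
  let z := w.1
  let x := w.2.1
  let y := w.2.2
  let zb := starRingEnd ℂ z
  (z + Xi3000 * z ^ 3 + Xi1200 * z * zb ^ 2 + Xi0300 * zb ^ 3 + Xi0120 * zb * x ^ 2 +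
      Xi0102 * zb * y ^ 2 + Xi0021 * x ^ 2 * y,
   x + Pi2010 * z ^ 2 * x + Pi0210 * zb ^ 2 * x + Pi1011 * z * x * y +
      Pi0111 * zb * x * y,
   y + Up1020 * z * x ^ 2 + Up0120 * zb * x ^ 2 + Up2001 * z ^ 2 * y +
      Up0201 * zb ^ 2 * y)

/-- The vector field `W` retaining only the resonant cubic monomials. -/
noncomputable def Wcubic (lam0 μ₁ μ₂ Z2100 Z1020 Z1002 C3 X1110 X0030 X0012 D1
    Y1101 Y0021 Y0003 : ℂ) (w : ℂ × ℂ × ℂ) : ℂ × ℂ × ℂ :=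
  let z := w.1
  let x := w.2.1
  let y := w.2.2
  let zb := starRingEnd ℂ z
  (lam0 * z + Z2100 * (z * zb) * z + Z1020 * z * x ^ 2 + Z1002 * z * y ^ 2,
   μ₁ * x + C3 * x * y + X1110 * (z * zb) * x + X0030 * x ^ 3 + X0012 * x * y ^ 2,
   μ₂ * y + D1 * x ^ 2 + Y1101 * (z * zb) * y + Y0021 * x ^ 2 * y + Y0003 * y ^ 3)

open Asymptotics Topology ComplexConjugate

section VanishingOrder

variable {E : Type*} [NormedAddCommGroup E]

/-- `f` vanishes to order at least `k` at the origin. -/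
def VanishesToOrder (k : ℕ) (f : E → ℂ) : Prop :=
  f =O[𝓝 0] fun w => ‖w‖ ^ k

namespace VanishesToOrder

variable {k l : ℕ} {f g u v w u' v' w' du dv dw : E → ℂ}

theorem add (hf : VanishesToOrder k f) (hg : VanishesToOrder k g) :
    VanishesToOrder k (fun p => f p + g p) :=
  IsBigO.add hf hg

theorem sub (hf : VanishesToOrder k f) (hg : VanishesToOrder k g) :
    VanishesToOrder k (fun p => f p - g p) :=
  IsBigO.sub hf hg

theorem const_mul (c : ℂ) (hf : VanishesToOrder k f) :
    VanishesToOrder k (fun p => c * f p) :=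
  IsBigO.const_mul_left hf c

theorem mul (hf : VanishesToOrder k f) (hg : VanishesToOrder l g) :
    VanishesToOrder (k + l) (fun p => f p * g p) := by
  simpa only [VanishesToOrder, pow_add] using IsBigO.mul hf hg

theorem map_conj (hf : VanishesToOrder k f) : VanishesToOrder k (fun p => conj (f p)) :=
  IsBigO.of_norm_left (by simpa only [RCLike.norm_conj] using IsBigO.norm_left hf)

theorem mono (hf : VanishesToOrder l f) (h : k ≤ l) : VanishesToOrder k f := by
  refine IsBigO.trans hf (IsBigO.of_bound 1 ?_)
  filter_upwards [Metric.ball_mem_nhds (0 : E) one_pos] with p hp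
  rw [mem_ball_zero_iff] at hp
  simpa using pow_le_pow_of_le_one (norm_nonneg p) hp.le h

theorem of_sub (hu : VanishesToOrder k u) (hu' : VanishesToOrder l (fun p => u' p - u p))
    (h : k ≤ l) : VanishesToOrder k u' := by
  simpa using hu.add (hu'.mono h)

theorem mul_sub_mul (hu : VanishesToOrder 1 u) (hv : VanishesToOrder 1 v)
    (hu' : VanishesToOrder (k + 1) (fun p => u' p - u p))
    (hv' : VanishesToOrder (k + 1) (fun p => v' p - v p)) :
    VanishesToOrder (k + 2) (fun p => u' p * v' p - u p * v p) := by
  have h := (hu'.mul (hv.of_sub hv' (by omega))).add (hv'.mul hu)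
  refine IsBigO.congr_left h fun p => ?_
  ring

theorem mul_mul (hu : VanishesToOrder 1 u) (hv : VanishesToOrder 1 v)
    (hw : VanishesToOrder 1 w) : VanishesToOrder 3 (fun p => u p * v p * w p) :=
  (hu.mul hv).mul hw

theorem mul_mul_sub_mul_mul (hu : VanishesToOrder 1 u) (hv : VanishesToOrder 1 v)
    (hw : VanishesToOrder 1 w)
    (hu' : VanishesToOrder 3 (fun p => u' p - u p))
    (hv' : VanishesToOrder 3 (fun p => v' p - v p))
    (hw' : VanishesToOrder 3 (fun p => w' p - w p)) :
    VanishesToOrder 4 (fun p => u' p * v' p * w' p - u p * v p * w p) := by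
  have h := ((hu.mul_sub_mul (k := 2) hv hu' hv').mul
    (hw.of_sub hw' (by omega))).add ((hw'.mul hu).mul hv)
  refine (show VanishesToOrder 5 _ from IsBigO.congr_left h fun p => ?_).mono (by omega)
  ring

theorem leibniz_mul_mul (hu : VanishesToOrder 1 u) (hv : VanishesToOrder 1 v)
    (hw : VanishesToOrder 1 w) (hdu : VanishesToOrder 2 du) (hdv : VanishesToOrder 2 dv)
    (hdw : VanishesToOrder 2 dw) :
    VanishesToOrder 4 (fun p => du p * v p * w p + u p * dv p * w p + u p * v p * dw p) :=
  (((hdu.mul hv).mul hw).add ((hu.mul hdv).mul hw)).add ((hu.mul hv).mul hdw)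

theorem exists_bound {F : E → ℂ × ℂ × ℂ} (h₁ : VanishesToOrder k fun p => (F p).1)
    (h₂ : VanishesToOrder k fun p => (F p).2.1) (h₃ : VanishesToOrder k fun p => (F p).2.2) :
    ∃ C δ : ℝ, 0 < C ∧ 0 < δ ∧ ∀ p : E, ‖p‖ < δ → ‖F p‖ ≤ C * ‖p‖ ^ k := by
  have h : F =O[𝓝 0] fun p => ‖p‖ ^ k := IsBigO.prod_left h₁ (IsBigO.prod_left h₂ h₃)
  obtain ⟨C, hC, hb⟩ := h.exists_pos
  obtain ⟨δ, hδ, hball⟩ := Metric.eventually_nhds_iff.1 hb.bound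
  refine ⟨C, δ, hC, hδ, fun p hp => ?_⟩
  simpa using hball (y := p) (by simpa using hp)

end VanishesToOrder

end VanishingOrder

theorem fderiv_phiCubic_apply (Xi3000 Xi1200 Xi0300 Xi0120 Xi0102 Xi0021 Pi2010 Pi0210
    Pi1011 Pi0111 Up1020 Up0120 Up2001 Up0201 : ℂ)
    (w v : ℂ × ℂ × ℂ) :
    fderiv ℝ (phiCubic Xi3000 Xi1200 Xi0300 Xi0120 Xi0102 Xi0021 Pi2010 Pi0210
      Pi1011 Pi0111 Up1020 Up0120 Up2001 Up0201) w v =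
    (v.1 + Xi3000 * (v.1 * w.1 * w.1 + w.1 * v.1 * w.1 + w.1 * w.1 * v.1) +
      Xi1200 * (v.1 * conj w.1 * conj w.1 + w.1 * conj v.1 * conj w.1 +
      w.1 * conj w.1 * conj v.1) + Xi0300 * (conj v.1 * conj w.1 * conj w.1 +
      conj w.1 * conj v.1 * conj w.1 + conj w.1 * conj w.1 * conj v.1) +
      Xi0120 * (conj v.1 * w.2.1 * w.2.1 + conj w.1 * v.2.1 * w.2.1 +
      conj w.1 * w.2.1 * v.2.1) + Xi0102 * (conj v.1 * w.2.2 * w.2.2 +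
      conj w.1 * v.2.2 * w.2.2 + conj w.1 * w.2.2 * v.2.2) + Xi0021 * (v.2.1 * w.2.1 * w.2.2 +
      w.2.1 * v.2.1 * w.2.2 + w.2.1 * w.2.1 * v.2.2),
      v.2.1 + Pi2010 * (v.1 * w.1 * w.2.1 + w.1 * v.1 * w.2.1 + w.1 * w.1 * v.2.1) +
      Pi0210 * (conj v.1 * conj w.1 * w.2.1 + conj w.1 * conj v.1 * w.2.1 +
      conj w.1 * conj w.1 * v.2.1) + Pi1011 * (v.1 * w.2.1 * w.2.2 + w.1 * v.2.1 * w.2.2 +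
      w.1 * w.2.1 * v.2.2) + Pi0111 * (conj v.1 * w.2.1 * w.2.2 + conj w.1 * v.2.1 * w.2.2 +
      conj w.1 * w.2.1 * v.2.2),
      v.2.2 + Up1020 * (v.1 * w.2.1 * w.2.1 + w.1 * v.2.1 * w.2.1 + w.1 * w.2.1 * v.2.1) +
      Up0120 * (conj v.1 * w.2.1 * w.2.1 + conj w.1 * v.2.1 * w.2.1 +
      conj w.1 * w.2.1 * v.2.1) + Up2001 * (v.1 * w.1 * w.2.2 + w.1 * v.1 * w.2.2 +
      w.1 * w.1 * v.2.2) + Up0201 * (conj v.1 * conj w.1 * w.2.2 + conj w.1 * conj v.1 * w.2.2 +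
      conj w.1 * conj w.1 * v.2.2)) := by
  have hz : HasFDerivAt (𝕜 := ℝ) (fun p : ℂ × ℂ × ℂ => p.1) _ w := hasFDerivAt_fst
  have hb : HasFDerivAt (𝕜 := ℝ) (fun p : ℂ × ℂ × ℂ => conj p.1) _ w :=
    (Complex.conjCLE : ℂ →L[ℝ] ℂ).hasFDerivAt.comp w hz
  have hx : HasFDerivAt (𝕜 := ℝ) (fun p : ℂ × ℂ × ℂ => p.2.1) _ w := hasFDerivAt_snd.fst
  have hy : HasFDerivAt (𝕜 := ℝ) (fun p : ℂ × ℂ × ℂ => p.2.2) _ w := hasFDerivAt_snd.snd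
  have h := ((((((hz.add
      (((hz.mul hz).mul hz).const_mul Xi3000)).add
      (((hz.mul hb).mul hb).const_mul Xi1200)).add
      (((hb.mul hb).mul hb).const_mul Xi0300)).add
      (((hb.mul hx).mul hx).const_mul Xi0120)).add
      (((hb.mul hy).mul hy).const_mul Xi0102)).add
      (((hx.mul hx).mul hy).const_mul Xi0021)).prodMk
    (((((hx.add
      (((hz.mul hz).mul hx).const_mul Pi2010)).add
      (((hb.mul hb).mul hx).const_mul Pi0210)).add
      (((hz.mul hx).mul hy).const_mul Pi1011)).add
      (((hb.mul hx).mul hy).const_mul Pi0111)).prodMk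
      ((((hy.add
      (((hz.mul hx).mul hx).const_mul Up1020)).add
      (((hb.mul hx).mul hx).const_mul Up0120)).add
      (((hz.mul hz).mul hy).const_mul Up2001)).add
      (((hb.mul hb).mul hy).const_mul Up0201)))
  have h' := h.congr_of_eventuallyEq
    (f₁ := phiCubic Xi3000 Xi1200 Xi0300 Xi0120 Xi0102 Xi0021 Pi2010 Pi0210
      Pi1011 Pi0111 Up1020 Up0120 Up2001 Up0201)
    (.of_forall fun p => by
      simp only [phiCubic, Pi.add_apply, Pi.mul_apply]
      refine Prod.ext ?_ (Prod.ext ?_ ?_) <;> dsimp only <;> ring)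
  rw [h'.fderiv]
  refine Prod.ext ?_ (Prod.ext ?_ ?_) <;> simp <;> ring

/-- Cubic near-identity normalization: under the stated non-resonance conditions there is
a cubic near-identity change of coordinates `φ` conjugating `V` to the resonant normal
form `W` (with the same resonant coefficients) up to a remainder of order `‖w‖⁴`. -/
theorem cubic_near_identity_normalization (lam0 μ₁ μ₂
    Z3000 Z2100 Z1200 Z0300 Z1020 Z0120 Z1002 Z0102 Z0021 C3
    X2010 X1110 X0210 X1011 X0111 X0030 X0012 D1
    Y1020 Y0120 Y2001 Y1101 Y0201 Y0021 Y0003 : ℂ)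
    (h1 : 2 * lam0 ≠ 0) (h2 : 2 * starRingEnd ℂ lam0 ≠ 0)
    (h3 : 3 * starRingEnd ℂ lam0 - lam0 ≠ 0)
    (h4 : starRingEnd ℂ lam0 - lam0 + 2 * μ₁ ≠ 0)
    (h5 : starRingEnd ℂ lam0 - lam0 + 2 * μ₂ ≠ 0)
    (h6 : 2 * μ₁ + μ₂ - lam0 ≠ 0)
    (h7 : lam0 + μ₂ ≠ 0) (h8 : starRingEnd ℂ lam0 + μ₂ ≠ 0)
    (h9 : μ₂ - 2 * μ₁ - lam0 ≠ 0) (h10 : μ₂ - 2 * μ₁ - starRingEnd ℂ lam0 ≠ 0) :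
    ∃ Xi3000 Xi1200 Xi0300 Xi0120 Xi0102 Xi0021
      Pi2010 Pi0210 Pi1011 Pi0111 Up1020 Up0120 Up2001 Up0201 : ℂ,
    ∃ C δ : ℝ, 0 < C ∧ 0 < δ ∧
      ∀ w : ℂ × ℂ × ℂ, ‖w‖ < δ →
        ‖Vcubic lam0 μ₁ μ₂ Z3000 Z2100 Z1200 Z0300 Z1020 Z0120 Z1002 Z0102 Z0021 C3
            X2010 X1110 X0210 X1011 X0111 X0030 X0012 D1
            Y1020 Y0120 Y2001 Y1101 Y0201 Y0021 Y0003
            (phiCubic Xi3000 Xi1200 Xi0300 Xi0120 Xi0102 Xi0021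
              Pi2010 Pi0210 Pi1011 Pi0111 Up1020 Up0120 Up2001 Up0201 w) -
          fderiv ℝ (phiCubic Xi3000 Xi1200 Xi0300 Xi0120 Xi0102 Xi0021
              Pi2010 Pi0210 Pi1011 Pi0111 Up1020 Up0120 Up2001 Up0201) w
            (Wcubic lam0 μ₁ μ₂ Z2100 Z1020 Z1002 C3 X1110 X0030 X0012 D1
              Y1101 Y0021 Y0003 w)‖ ≤ C * ‖w‖ ^ 4 := by
  have solve : ∀ {a : ℂ}, a ≠ 0 → ∀ b, ∃ c, b = a * c := fun ha b =>
    ⟨b / _, (mul_div_cancel₀ b ha).symm⟩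
  obtain ⟨Xi3000, rfl⟩ := solve h1 Z3000
  obtain ⟨Xi1200, rfl⟩ := solve h2 Z1200
  obtain ⟨Xi0300, rfl⟩ := solve h3 Z0300
  obtain ⟨Xi0120, rfl⟩ := solve h4 Z0120
  obtain ⟨Xi0102, rfl⟩ := solve h5 Z0102
  obtain ⟨Xi0021, rfl⟩ := solve h6 Z0021
  obtain ⟨Pi2010, rfl⟩ := solve h1 X2010
  obtain ⟨Pi0210, rfl⟩ := solve h2 X0210
  obtain ⟨Pi1011, rfl⟩ := solve h7 X1011
  obtain ⟨Pi0111, rfl⟩ := solve h8 X0111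
  obtain ⟨Up1020, rfl⟩ := solve (neg_ne_zero.2 h9) Y1020
  obtain ⟨Up0120, rfl⟩ := solve (neg_ne_zero.2 h10) Y0120
  obtain ⟨Up2001, rfl⟩ := solve h1 Y2001
  obtain ⟨Up0201, rfl⟩ := solve h2 Y0201
  set φ := phiCubic Xi3000 Xi1200 Xi0300 Xi0120 Xi0102 Xi0021 Pi2010 Pi0210
    Pi1011 Pi0111 Up1020 Up0120 Up2001 Up0201 with hφ
  set W := Wcubic lam0 μ₁ μ₂ Z2100 Z1020 Z1002 C3 X1110 X0030 X0012 D1 Y1101 Y0021 Y0003 with hW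
  have hz : VanishesToOrder 1 fun w : ℂ × ℂ × ℂ => w.1 :=
    IsBigO.of_bound 1 (.of_forall fun w => by simpa using norm_fst_le w)
  have hb : VanishesToOrder 1 fun w : ℂ × ℂ × ℂ => conj w.1 := hz.map_conj
  have hx : VanishesToOrder 1 fun w : ℂ × ℂ × ℂ => w.2.1 :=
    IsBigO.of_bound 1 (.of_forall fun w => by
      simpa using (norm_fst_le w.2).trans (norm_snd_le w))
  have hy : VanishesToOrder 1 fun w : ℂ × ℂ × ℂ => w.2.2 :=
    IsBigO.of_bound 1 (.of_forall fun w => by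
      simpa using (norm_snd_le w.2).trans (norm_snd_le w))
  have hzφ : VanishesToOrder 3 fun w => (φ w).1 - w.1 := by
    refine IsBigO.congr_left (((((((hz.mul_mul hz hz).const_mul Xi3000).add
      ((hz.mul_mul hb hb).const_mul Xi1200)).add
      ((hb.mul_mul hb hb).const_mul Xi0300)).add
      ((hb.mul_mul hx hx).const_mul Xi0120)).add
      ((hb.mul_mul hy hy).const_mul Xi0102)).add
      ((hx.mul_mul hx hy).const_mul Xi0021)) fun w => ?_
    simp only [hφ, phiCubic]
    ring
  have hxφ : VanishesToOrder 3 fun w => (φ w).2.1 - w.2.1 := by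
    refine IsBigO.congr_left (((((hz.mul_mul hz hx).const_mul Pi2010).add
      ((hb.mul_mul hb hx).const_mul Pi0210)).add
      ((hz.mul_mul hx hy).const_mul Pi1011)).add
      ((hb.mul_mul hx hy).const_mul Pi0111)) fun w => ?_
    simp only [hφ, phiCubic]
    ring
  have hyφ : VanishesToOrder 3 fun w => (φ w).2.2 - w.2.2 := by
    refine IsBigO.congr_left (((((hz.mul_mul hx hx).const_mul Up1020).add
      ((hb.mul_mul hx hx).const_mul Up0120)).add
      ((hz.mul_mul hz hy).const_mul Up2001)).add
      ((hb.mul_mul hb hy).const_mul Up0201)) fun w => ?_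
    simp only [hφ, phiCubic]
    ring
  have hbφ : VanishesToOrder 3 fun w => conj (φ w).1 - conj w.1 := by
    simpa only [map_sub] using hzφ.map_conj
  have hzW : VanishesToOrder 2 fun w => (W w).1 - lam0 * w.1 := by
    refine IsBigO.congr_left (((((hz.mul_mul hb hz).const_mul Z2100).add
      ((hz.mul_mul hx hx).const_mul Z1020)).add
      ((hz.mul_mul hy hy).const_mul Z1002)).mono (k := 2) (by omega)) fun w => ?_
    simp only [hW, Wcubic]
    ring
  have hxW : VanishesToOrder 2 fun w => (W w).2.1 - μ₁ * w.2.1 := by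
    refine IsBigO.congr_left (((hx.mul hy).const_mul C3).add
      ((((((hz.mul_mul hb hx).const_mul X1110).add
      ((hx.mul_mul hx hx).const_mul X0030)).add
      ((hx.mul_mul hy hy).const_mul X0012)).mono (k := 2) (by omega)))) fun w => ?_
    simp only [hW, Wcubic]
    ring
  have hyW : VanishesToOrder 2 fun w => (W w).2.2 - μ₂ * w.2.2 := by
    refine IsBigO.congr_left (((hx.mul hx).const_mul D1).add
      ((((((hz.mul_mul hb hy).const_mul Y1101).add
      ((hx.mul_mul hx hy).const_mul Y0021)).add
      ((hy.mul_mul hy hy).const_mul Y0003)).mono (k := 2) (by omega)))) fun w => ?_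
    simp only [hW, Wcubic]
    ring
  have hbW : VanishesToOrder 2 fun w => conj (W w).1 - conj lam0 * conj w.1 := by
    simpa only [map_sub, map_mul] using hzW.map_conj
  refine ⟨Xi3000, Xi1200, Xi0300, Xi0120, Xi0102, Xi0021, Pi2010, Pi0210,
    Pi1011, Pi0111, Up1020, Up0120, Up2001, Up0201,
    VanishesToOrder.exists_bound ?_ ?_ ?_⟩
  · refine IsBigO.congr_left ((((((((((((hz.mul_mul_sub_mul_mul hz hz hzφ hzφ hzφ).const_mul
        (2 * lam0 * Xi3000)).add
      ((hz.mul_mul_sub_mul_mul hb hz hzφ hbφ hzφ).const_mul Z2100)).add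
      ((hz.mul_mul_sub_mul_mul hb hb hzφ hbφ hbφ).const_mul
        (2 * conj lam0 * Xi1200))).add
      ((hb.mul_mul_sub_mul_mul hb hb hbφ hbφ hbφ).const_mul
        ((3 * conj lam0 - lam0) * Xi0300))).add
      ((hz.mul_mul_sub_mul_mul hx hx hzφ hxφ hxφ).const_mul Z1020)).add
      ((hb.mul_mul_sub_mul_mul hx hx hbφ hxφ hxφ).const_mul
        ((conj lam0 - lam0 + 2 * μ₁) * Xi0120))).add
      ((hz.mul_mul_sub_mul_mul hy hy hzφ hyφ hyφ).const_mul Z1002)).add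
      ((hb.mul_mul_sub_mul_mul hy hy hbφ hyφ hyφ).const_mul
        ((conj lam0 - lam0 + 2 * μ₂) * Xi0102))).add
      ((hx.mul_mul_sub_mul_mul hx hy hxφ hxφ hyφ).const_mul
        ((2 * μ₁ + μ₂ - lam0) * Xi0021)))).sub
      (((((((hz.leibniz_mul_mul hz hz hzW hzW hzW).const_mul Xi3000).add
      ((hz.leibniz_mul_mul hb hb hzW hbW hbW).const_mul Xi1200)).add
      ((hb.leibniz_mul_mul hb hb hbW hbW hbW).const_mul Xi0300)).add
      ((hb.leibniz_mul_mul hx hx hbW hxW hxW).const_mul Xi0120)).add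
      ((hb.leibniz_mul_mul hy hy hbW hyW hyW).const_mul Xi0102)).add
      ((hx.leibniz_mul_mul hx hy hxW hxW hyW).const_mul Xi0021))) fun w => ?_
    have hφw : (φ w).1 = w.1 +
        (Xi3000 * (w.1 * w.1 * w.1) + Xi1200 * (w.1 * conj w.1 * conj w.1) +
        Xi0300 * (conj w.1 * conj w.1 * conj w.1) + Xi0120 * (conj w.1 * w.2.1 * w.2.1) +
        Xi0102 * (conj w.1 * w.2.2 * w.2.2) + Xi0021 * (w.2.1 * w.2.1 * w.2.2)) := by
      simp only [hφ, phiCubic]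
      ring
    have hWw : (W w).1 =
        lam0 * w.1 + Z2100 * (w.1 * conj w.1 * w.1) + Z1020 * (w.1 * w.2.1 * w.2.1) +
        Z1002 * (w.1 * w.2.2 * w.2.2) := by
      simp only [hW, Wcubic]
      ring
    rw [hφ, fderiv_phiCubic_apply, ← hφ]
    simp only [Vcubic, Prod.fst_sub]
    linear_combination -lam0 * hφw + hWw
  · refine IsBigO.congr_left (((((((((((hx.mul_sub_mul (k := 2) hy hxφ hyφ).const_mul C3).add
      ((hz.mul_mul_sub_mul_mul hz hx hzφ hzφ hxφ).const_mul
        (2 * lam0 * Pi2010))).add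
      ((hz.mul_mul_sub_mul_mul hb hx hzφ hbφ hxφ).const_mul X1110)).add
      ((hb.mul_mul_sub_mul_mul hb hx hbφ hbφ hxφ).const_mul
        (2 * conj lam0 * Pi0210))).add
      ((hz.mul_mul_sub_mul_mul hx hy hzφ hxφ hyφ).const_mul
        ((lam0 + μ₂) * Pi1011))).add
      ((hb.mul_mul_sub_mul_mul hx hy hbφ hxφ hyφ).const_mul
        ((conj lam0 + μ₂) * Pi0111))).add
      ((hx.mul_mul_sub_mul_mul hx hx hxφ hxφ hxφ).const_mul X0030)).add
      ((hx.mul_mul_sub_mul_mul hy hy hxφ hyφ hyφ).const_mul X0012))).sub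
      (((((hz.leibniz_mul_mul hz hx hzW hzW hxW).const_mul Pi2010).add
      ((hb.leibniz_mul_mul hb hx hbW hbW hxW).const_mul Pi0210)).add
      ((hz.leibniz_mul_mul hx hy hzW hxW hyW).const_mul Pi1011)).add
      ((hb.leibniz_mul_mul hx hy hbW hxW hyW).const_mul Pi0111))) fun w => ?_
    have hφw : (φ w).2.1 = w.2.1 +
        (Pi2010 * (w.1 * w.1 * w.2.1) + Pi0210 * (conj w.1 * conj w.1 * w.2.1) +
        Pi1011 * (w.1 * w.2.1 * w.2.2) + Pi0111 * (conj w.1 * w.2.1 * w.2.2)) := by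
      simp only [hφ, phiCubic]
      ring
    have hWw : (W w).2.1 =
        μ₁ * w.2.1 + C3 * (w.2.1 * w.2.2) + X1110 * (w.1 * conj w.1 * w.2.1) +
        X0030 * (w.2.1 * w.2.1 * w.2.1) + X0012 * (w.2.1 * w.2.2 * w.2.2) := by
      simp only [hW, Wcubic]
      ring
    rw [hφ, fderiv_phiCubic_apply, ← hφ]
    simp only [Vcubic, Prod.fst_sub, Prod.snd_sub]
    linear_combination -μ₁ * hφw + hWw
  · refine IsBigO.congr_left (((((((((((hx.mul_sub_mul (k := 2) hx hxφ hxφ).const_mul D1).add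
      ((hz.mul_mul_sub_mul_mul hx hx hzφ hxφ hxφ).const_mul
        (-(μ₂ - 2 * μ₁ - lam0) * Up1020))).add
      ((hb.mul_mul_sub_mul_mul hx hx hbφ hxφ hxφ).const_mul
        (-(μ₂ - 2 * μ₁ - conj lam0) * Up0120))).add
      ((hz.mul_mul_sub_mul_mul hz hy hzφ hzφ hyφ).const_mul
        (2 * lam0 * Up2001))).add
      ((hz.mul_mul_sub_mul_mul hb hy hzφ hbφ hyφ).const_mul Y1101)).add
      ((hb.mul_mul_sub_mul_mul hb hy hbφ hbφ hyφ).const_mul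
        (2 * conj lam0 * Up0201))).add
      ((hx.mul_mul_sub_mul_mul hx hy hxφ hxφ hyφ).const_mul Y0021)).add
      ((hy.mul_mul_sub_mul_mul hy hy hyφ hyφ hyφ).const_mul Y0003))).sub
      (((((hz.leibniz_mul_mul hx hx hzW hxW hxW).const_mul Up1020).add
      ((hb.leibniz_mul_mul hx hx hbW hxW hxW).const_mul Up0120)).add
      ((hz.leibniz_mul_mul hz hy hzW hzW hyW).const_mul Up2001)).add
      ((hb.leibniz_mul_mul hb hy hbW hbW hyW).const_mul Up0201))) fun w => ?_
    have hφw : (φ w).2.2 = w.2.2 +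
        (Up1020 * (w.1 * w.2.1 * w.2.1) + Up0120 * (conj w.1 * w.2.1 * w.2.1) +
        Up2001 * (w.1 * w.1 * w.2.2) + Up0201 * (conj w.1 * conj w.1 * w.2.2)) := by
      simp only [hφ, phiCubic]
      ring
    have hWw : (W w).2.2 =
        μ₂ * w.2.2 + D1 * (w.2.1 * w.2.1) + Y1101 * (w.1 * conj w.1 * w.2.2) +
        Y0021 * (w.2.1 * w.2.1 * w.2.2) + Y0003 * (w.2.2 * w.2.2 * w.2.2) := by
      simp only [hW, Wcubic]
      ring
    rw [hφ, fderiv_phiCubic_apply, ← hφ]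
    simp only [Vcubic, Prod.snd_sub]
    linear_combination -μ₂ * hφw + hWw
end
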